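/- arXiv:math/0602378 — 4 statements merged into one kernel-verified Lean document; each statement's English description precedes it below -/
import Mathlib

section
/- Let n = 2d and let A, B ∈ Sym(2d,ℝ) be linearly independent, forming a non-dissipative pair with max{rank A, rank B} ≥ 7. Let C := 2(BJA − AJB) ∈ Sym(2d,ℝ), so that Q_C = {Q_A, Q_B} is the Poisson bracket of Q_A and Q_B, and assume Q_C(x) = 0 for every x with Q_A(x) = 0 and Q_B(x) = 0. Assume the joint radical ker A ∩ ker B is either {0} or a symplectic subspace of ℝ^{2d}. If no connected component of 𝒩 spans ℝ^{2d}, then C is a linear combination of A and B. -/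
open Matrix

/-- The standard symplectic matrix `J = [[0, I_d], [−I_d, 0]]` on `ℝ^{2d} = ℝ^d × ℝ^d`. -/
noncomputable def symplJ (d : ℕ) : Matrix (Fin d ⊕ Fin d) (Fin d ⊕ Fin d) ℝ :=
  Matrix.fromBlocks 0 1 (-1) 0

section QuadraticPairs

variable {n : Type*} [Fintype n]

lemma Matrix.IsSymm.dotProduct_mulVec_swap {G : Matrix n n ℝ} (hG : G.IsSymm) (x y : n → ℝ) :
    x ⬝ᵥ G *ᵥ y = y ⬝ᵥ G *ᵥ x := by
  rw [dotProduct_mulVec, ← mulVec_transpose, hG.eq, dotProduct_comm]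

lemma Matrix.IsSymm.quadForm_add_smul {G : Matrix n n ℝ} (hG : G.IsSymm) (x y : n → ℝ) (s : ℝ) :
    (x + s • y) ⬝ᵥ G *ᵥ (x + s • y) =
      x ⬝ᵥ G *ᵥ x + 2 * (x ⬝ᵥ G *ᵥ y) * s + y ⬝ᵥ G *ᵥ y * s ^ 2 := by
  simp only [mulVec_add, mulVec_smul, dotProduct_add, add_dotProduct, smul_dotProduct,
    dotProduct_smul, smul_eq_mul]
  linear_combination s * hG.dotProduct_mulVec_swap y x

lemma Matrix.IsSymm.quadForm_add_add {G : Matrix n n ℝ} (hG : G.IsSymm) (x y z : n → ℝ)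
    (a b c : ℝ) :
    (a • x + b • y + c • z) ⬝ᵥ G *ᵥ (a • x + b • y + c • z) =
      a ^ 2 * (x ⬝ᵥ G *ᵥ x) + b ^ 2 * (y ⬝ᵥ G *ᵥ y) + c ^ 2 * (z ⬝ᵥ G *ᵥ z)
        + 2 * a * b * (x ⬝ᵥ G *ᵥ y) + 2 * a * c * (x ⬝ᵥ G *ᵥ z) + 2 * b * c * (y ⬝ᵥ G *ᵥ z) := by
  simp only [mulVec_add, mulVec_smul, dotProduct_add, add_dotProduct, smul_dotProduct,
    dotProduct_smul, smul_eq_mul]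
  linear_combination a * b * hG.dotProduct_mulVec_swap y x +
    a * c * hG.dotProduct_mulVec_swap z x + b * c * hG.dotProduct_mulVec_swap z y

/-- A real quadratic with coefficients of opposite sign has a negative and a positive root. -/
lemma exists_roots_of_pos_of_neg {α γ : ℝ} (hα : 0 < α) (hγ : γ < 0) (β : ℝ) :
    ∃ s t : ℝ, s < 0 ∧ 0 < t ∧ α + 2 * β * s + γ * s ^ 2 = 0 ∧
      α + 2 * β * t + γ * t ^ 2 = 0 ∧ s * t * γ = α := by
  have hγ' := hγ.ne
  have hD : 0 ≤ β ^ 2 - α * γ := by nlinarith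
  have hr := Real.sq_sqrt hD
  set r := √(β ^ 2 - α * γ)
  have hr0 : 0 ≤ r := Real.sqrt_nonneg _
  have hlt : |β| < r := by
    apply abs_lt_of_sq_lt_sq _ hr0
    nlinarith
  obtain ⟨h1, h2⟩ := abs_lt.mp hlt
  refine ⟨(-β + r) / γ, (-β - r) / γ, div_neg_of_pos_of_neg (by linarith) hγ,
    div_pos_of_neg_of_neg (by linarith) hγ, ?_, ?_, ?_⟩
  · field_simp
    linear_combination hr
  · field_simp
    linear_combination hr
  · field_simp
    linear_combination -hr

/-- The S-lemma for an equality constraint. -/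
lemma exists_nonneg_combination {F G : Matrix n n ℝ} (hF : F.IsSymm) (hG : G.IsSymm)
    {x₀ y₀ : n → ℝ} (hx₀ : 0 < x₀ ⬝ᵥ F *ᵥ x₀) (hy₀ : y₀ ⬝ᵥ F *ᵥ y₀ < 0)
    (h : ∀ x, x ⬝ᵥ F *ᵥ x = 0 → 0 ≤ x ⬝ᵥ G *ᵥ x) :
    ∃ t : ℝ, ∀ x, 0 ≤ x ⬝ᵥ G *ᵥ x + t * (x ⬝ᵥ F *ᵥ x) := by
  have key : ∀ x y, 0 < x ⬝ᵥ F *ᵥ x → y ⬝ᵥ F *ᵥ y < 0 →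
      -(x ⬝ᵥ G *ᵥ x) / (x ⬝ᵥ F *ᵥ x) ≤ -(y ⬝ᵥ G *ᵥ y) / (y ⬝ᵥ F *ᵥ y) := by
    intro x y hx hy
    obtain ⟨s, t, hs, ht, h1, h2, h3⟩ := exists_roots_of_pos_of_neg hx hy (x ⬝ᵥ F *ᵥ y)
    have e1 := h (x + s • y) (by rw [hF.quadForm_add_smul, h1])
    have e2 := h (x + t • y) (by rw [hF.quadForm_add_smul, h2])
    rw [hG.quadForm_add_smul] at e1 e2
    have e3 : 0 ≤ (t - s) * (x ⬝ᵥ G *ᵥ x - s * t * (y ⬝ᵥ G *ᵥ y)) := by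
      nlinarith [mul_nonneg ht.le e1, mul_nonneg (neg_pos.mpr hs).le e2]
    have e4 := nonneg_of_mul_nonneg_right e3 (by linarith)
    have e5 : s * t = x ⬝ᵥ F *ᵥ x / y ⬝ᵥ F *ᵥ y := (eq_div_iff hy.ne).mpr h3
    rw [div_le_iff₀ hx]
    have : -(y ⬝ᵥ G *ᵥ y) / (y ⬝ᵥ F *ᵥ y) * (x ⬝ᵥ F *ᵥ x) = - (s * t * (y ⬝ᵥ G *ᵥ y)) := by
      rw [e5]; ring
    linarith
  let S : Set ℝ := {r | ∃ x, 0 < x ⬝ᵥ F *ᵥ x ∧ r = -(x ⬝ᵥ G *ᵥ x) / (x ⬝ᵥ F *ᵥ x)}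
  have hne : S.Nonempty := ⟨_, x₀, hx₀, rfl⟩
  have hbd : ∀ y, y ⬝ᵥ F *ᵥ y < 0 → -(y ⬝ᵥ G *ᵥ y) / (y ⬝ᵥ F *ᵥ y) ∈ upperBounds S := by
    rintro y hy _ ⟨x, hx, rfl⟩
    exact key x y hx hy
  refine ⟨sSup S, fun x => ?_⟩
  rcases lt_trichotomy (x ⬝ᵥ F *ᵥ x) 0 with hx | hx | hx
  · have := csSup_le hne (hbd x hx)
    rw [le_div_iff_of_neg hx] at this
    linarith
  · rw [hx, mul_zero, add_zero]
    exact h x hx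
  · have := le_csSup ⟨_, hbd y₀ hy₀⟩ (show _ ∈ S from ⟨x, hx, rfl⟩)
    rw [div_le_iff₀ hx] at this
    linarith

lemma mulVec_add_smul_ne_zero {G : Matrix n n ℝ} (hG : G.IsSymm) {x y : n → ℝ}
    (hx : 0 < x ⬝ᵥ G *ᵥ x) (hy : y ⬝ᵥ G *ᵥ y < 0) (s : ℝ) : G *ᵥ (x + s • y) ≠ 0 := by
  intro h0
  have e1 : x ⬝ᵥ G *ᵥ (x + s • y) = 0 := by rw [h0, dotProduct_zero]
  have e2 : y ⬝ᵥ G *ᵥ (x + s • y) = 0 := by rw [h0, dotProduct_zero]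
  rw [mulVec_add, mulVec_smul, dotProduct_add, dotProduct_smul, smul_eq_mul] at e1 e2
  rw [hG.dotProduct_mulVec_swap y x] at e2
  have e3 : x ⬝ᵥ G *ᵥ x = s ^ 2 * (y ⬝ᵥ G *ᵥ y) := by linear_combination e1 - s * e2
  linarith [mul_nonneg (sq_nonneg s) (neg_pos.mpr hy).le]

/-- Nonsingular zeros of an indefinite quadratic form span. -/
lemma dotProduct_eq_zero_of_null {G : Matrix n n ℝ} (hG : G.IsSymm) (H : Submodule ℝ (n → ℝ))
    {a b q : n → ℝ} (ha : a ∈ H) (hb : b ∈ H) (hapos : 0 < a ⬝ᵥ G *ᵥ a)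
    (hbneg : b ⬝ᵥ G *ᵥ b < 0)
    (h : ∀ x ∈ H, x ⬝ᵥ G *ᵥ x = 0 → G *ᵥ x ≠ 0 → q ⬝ᵥ x = 0) :
    ∀ x ∈ H, q ⬝ᵥ x = 0 := by
  have key : ∀ x ∈ H, ∀ y ∈ H, 0 < x ⬝ᵥ G *ᵥ x → y ⬝ᵥ G *ᵥ y < 0 →
      q ⬝ᵥ x = 0 ∧ q ⬝ᵥ y = 0 := by
    intro x hx y hy hxp hyn
    obtain ⟨s, t, hs, ht, h1, h2, -⟩ := exists_roots_of_pos_of_neg hxp hyn (x ⬝ᵥ G *ᵥ y)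
    have aux : ∀ s : ℝ, x ⬝ᵥ G *ᵥ x + 2 * (x ⬝ᵥ G *ᵥ y) * s + y ⬝ᵥ G *ᵥ y * s ^ 2 = 0 →
        q ⬝ᵥ x + s * (q ⬝ᵥ y) = 0 := by
      intro s hs
      have := h (x + s • y) (H.add_mem hx (H.smul_mem s hy))
        (by rw [hG.quadForm_add_smul, hs]) (mulVec_add_smul_ne_zero hG hxp hyn s)
      rwa [dotProduct_add, dotProduct_smul, smul_eq_mul] at this
    have e1 := aux s h1
    have e2 := aux t h2
    have e3 : (t - s) * (q ⬝ᵥ y) = 0 := by linarith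
    have e4 : q ⬝ᵥ y = 0 := (mul_eq_zero.mp e3).resolve_left (by linarith)
    exact ⟨by rw [e4] at e1; linarith, e4⟩
  intro x hx
  rcases lt_trichotomy (x ⬝ᵥ G *ᵥ x) 0 with h0 | h0 | h0
  · exact (key a ha x hx hapos h0).2
  · by_cases h1 : G *ᵥ x = 0
    · have e := (key (a + (1 : ℝ) • x) (H.add_mem ha (H.smul_mem 1 hx)) b hb (by
        rw [hG.quadForm_add_smul, h0, h1, dotProduct_zero]; linarith) hbneg).1
      rw [dotProduct_add, dotProduct_smul, (key a ha b hb hapos hbneg).1] at e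
      simpa using e
    · exact h x hx h0 h1
  · exact (key x hx b hb h0 hbneg).1

/-- A conic and a hyperbola with asymptotes parallel to the axes meet, provided that the asymptotes
of the hyperbola separate those of the conic. -/
lemma exists_common_zero_of_conics {a b b' : ℝ} (ha : a ≠ 0) (hb : 0 < b) (hb' : 0 < b')
    (l₁ l₂ c m l₃ l₄ c' : ℝ) :
    ∃ x y : ℝ, a * (x * y) + l₁ * x + l₂ * y + c = 0 ∧
      b * x ^ 2 + m * (x * y) - b' * y ^ 2 + l₃ * x + l₄ * y + c' = 0 := by
  have base : ∀ κ l l' c : ℝ, ∃ x y : ℝ, x * y = κ ∧ b * x ^ 2 - b' * y ^ 2 + l * x + l' * y + c = 0 := by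
    intro κ l l' c
    have root : ∀ b l c : ℝ, 0 < b → c ≤ 0 → ∃ x : ℝ, b * x ^ 2 + l * x + c = 0 := by
      intro b l c hb hc
      have hD : 0 ≤ discrim b l c := by unfold discrim; nlinarith
      obtain ⟨x, hx⟩ := exists_quadratic_eq_zero hb.ne' ⟨√(discrim b l c), (Real.mul_self_sqrt hD).symm⟩
      exact ⟨x, by linarith⟩
    by_cases hκ : κ = 0
    · rcases le_total c 0 with hc | hc
      · obtain ⟨x, hx⟩ := root b l c hb hc
        exact ⟨x, 0, by simp [hκ], by linarith⟩
      · obtain ⟨y, hy⟩ := root b' (-l') (-c) hb' (by linarith)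
        exact ⟨0, y, by simp [hκ], by linarith⟩
    · let f : ℝ → ℝ := fun x => b * x ^ 4 + l * x ^ 3 + c * x ^ 2 + l' * κ * x - b' * κ ^ 2
      have hf : Continuous f := by fun_prop
      have hf0 : f 0 < 0 := by
        have : 0 < b' * κ ^ 2 := by positivity
        simp [f]; linarith
      obtain ⟨M, hM0, hM⟩ : ∃ M : ℝ, 0 ≤ M ∧ 0 ≤ f M := by
        set K := |l| + |c| + |l' * κ| + b' * κ ^ 2 with hK
        have hK0 : 0 ≤ K := by positivity
        set M := 1 + K / b
        have hM1 : 1 ≤ M := by simp only [M]; linarith [div_nonneg hK0 hb.le]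
        have hbM : b * M = b + K := by simp only [M]; field_simp
        refine ⟨M, by linarith, ?_⟩
        have h3 : 1 ≤ M ^ 3 := one_le_pow₀ hM1
        have h23 : M ^ 2 ≤ M ^ 3 := pow_le_pow_right₀ hM1 (by norm_num)
        have h13 : M ≤ M ^ 3 := le_self_pow₀ hM1 (by norm_num)
        have e1 : -(|l| * M ^ 3) ≤ l * M ^ 3 := by nlinarith [neg_abs_le l]
        have e2 : -(|c| * M ^ 3) ≤ c * M ^ 2 := by
          nlinarith [neg_abs_le c, abs_nonneg c, mul_le_mul_of_nonneg_left h23 (abs_nonneg c)]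
        have e3 : -(|l' * κ| * M ^ 3) ≤ l' * κ * M := by
          nlinarith [neg_abs_le (l' * κ), mul_le_mul_of_nonneg_left h13 (abs_nonneg (l' * κ))]
        have e4 : b' * κ ^ 2 ≤ b' * κ ^ 2 * M ^ 3 :=
          le_mul_of_one_le_right (by positivity) h3
        have e5 : b * M ^ 4 = (b + K) * M ^ 3 := by rw [← hbM]; ring
        have e6 : 0 ≤ b * M ^ 3 := by positivity
        simp only [f]
        rw [e5, hK]
        linarith
      obtain ⟨x, -, hx⟩ := intermediate_value_Icc hM0 hf.continuousOn ⟨hf0.le, hM⟩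
      have hx0 : x ≠ 0 := by
        rintro rfl
        exact hf0.ne hx
      refine ⟨x, κ / x, by field_simp, ?_⟩
      simp only [f] at hx
      field_simp
      linear_combination hx
  obtain ⟨X, Y, h1, h2⟩ := base (l₁ * l₂ / a ^ 2 - c / a) (l₃ - m * l₁ / a - 2 * b * l₂ / a)
    (l₄ - m * l₂ / a + 2 * b' * l₁ / a)
    (c' - m * c / a - (l₃ - m * l₁ / a) * l₂ / a - (l₄ - m * l₂ / a) * l₁ / a
      + b * (l₂ / a) ^ 2 - b' * (l₁ / a) ^ 2)
  have h3 : a * ((X - l₂ / a) * (Y - l₁ / a)) + l₁ * (X - l₂ / a) + l₂ * (Y - l₁ / a) + c = 0 := by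
    have : a * (X * Y) = l₁ * l₂ / a - c := by rw [h1]; field_simp
    field_simp
    field_simp at this
    linear_combination this
  refine ⟨X - l₂ / a, Y - l₁ / a, h3, ?_⟩
  have h4 : m * ((X - l₂ / a) * (Y - l₁ / a)) = -(m / a) * (l₁ * (X - l₂ / a) + l₂ * (Y - l₁ / a) + c) := by
    field_simp
    field_simp at h3
    linear_combination m * h3
  linear_combination h2 + h4

end QuadraticPairs

section QuadraticPairs

variable {n : Type*} [Fintype n]

/-- No nontrivial combination of the quadratic forms of `A` and `B` is positive semidefinite. -/
def IndefinitePair (A B : Matrix n n ℝ) : Prop :=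
  ∀ a b : ℝ, (∀ x, 0 ≤ a * (x ⬝ᵥ A *ᵥ x) + b * (x ⬝ᵥ B *ᵥ x)) → a = 0 ∧ b = 0

/-- The quadratic form of `G` vanishes identically on no intersection of three hyperplanes. -/
def NonvanishingOnCodimThree (G : Matrix n n ℝ) : Prop :=
  ∀ u₁ u₂ u₃ : n → ℝ, ∃ w, u₁ ⬝ᵥ w = 0 ∧ u₂ ⬝ᵥ w = 0 ∧ u₃ ⬝ᵥ w = 0 ∧ w ⬝ᵥ G *ᵥ w ≠ 0

lemma dotProduct_mulVec_eq_zero_of_isotropic {G : Matrix n n ℝ} (hG : G.IsSymm)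
    (W : Submodule ℝ (n → ℝ)) (h : ∀ x ∈ W, x ⬝ᵥ G *ᵥ x = 0) {x y : n → ℝ} (hx : x ∈ W)
    (hy : y ∈ W) : x ⬝ᵥ G *ᵥ y = 0 := by
  have := hG.quadForm_add_smul x y 1
  rw [h _ (W.add_mem hx (W.smul_mem 1 hy)), h x hx, h y hy] at this
  linarith

lemma rank_add_finrank_le_of_isotropic [DecidableEq n] {G : Matrix n n ℝ} (hG : G.IsSymm)
    (W : Submodule ℝ (n → ℝ)) (h : ∀ x ∈ W, x ⬝ᵥ G *ᵥ x = 0) :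
    G.rank + 2 * Module.finrank ℝ W ≤ 2 * Fintype.card n := by
  obtain ⟨W', hW'⟩ := W.exists_isCompl
  have hdim := Submodule.finrank_add_eq_of_isCompl hW'
  rw [Module.finrank_fintype_fun_eq_card] at hdim
  let L : W →ₗ[ℝ] W' →ₗ[ℝ] ℝ := LinearMap.mk₂ ℝ (fun w w' => (w' : n → ℝ) ⬝ᵥ G *ᵥ (w : n → ℝ))
    (by intros; simp [mulVec_add]) (by intros; simp [mulVec_smul])
    (by intros; simp) (by intros; simp)
  have hL := L.finrank_range_add_finrank_ker
  have hr : Module.finrank ℝ L.range ≤ Module.finrank ℝ W' := by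
    refine (Submodule.finrank_le _).trans ?_
    exact (Subspace.dual_finrank_eq (K := ℝ) (V := W')).le
  have hk : Module.finrank ℝ L.ker ≤ Module.finrank ℝ G.mulVecLin.ker := by
    rw [← Submodule.finrank_map_subtype_eq]
    refine Submodule.finrank_mono ?_
    rintro _ ⟨w, hw, rfl⟩
    have hz : ∀ y, y ⬝ᵥ G *ᵥ (w : n → ℝ) = 0 := by
      intro y
      obtain ⟨y₁, hy₁, y₂, hy₂, rfl⟩ := Submodule.mem_sup.mp
        (hW'.sup_eq_top ▸ Submodule.mem_top : y ∈ W ⊔ W')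
      rw [add_dotProduct, dotProduct_mulVec_eq_zero_of_isotropic hG W h hy₁ w.2, zero_add]
      exact LinearMap.congr_fun (LinearMap.mem_ker.mp hw) ⟨y₂, hy₂⟩
    exact dotProduct_self_eq_zero.mp (hz _)
  have hG' := G.mulVecLin.finrank_range_add_finrank_ker
  rw [Module.finrank_fintype_fun_eq_card] at hG'
  have : G.rank = Module.finrank ℝ G.mulVecLin.range := rfl
  omega

lemma nonvanishingOnCodimThree_of_rank [DecidableEq n] {G : Matrix n n ℝ} (hG : G.IsSymm)
    (h : 7 ≤ G.rank) : NonvanishingOnCodimThree G := by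
  intro u₁ u₂ u₃
  by_contra! hc
  let U : Matrix (Fin 3) n ℝ := Matrix.of ![u₁, u₂, u₃]
  have h1 := rank_add_finrank_le_of_isotropic hG U.mulVecLin.ker (fun x hx => by
    have hx : U *ᵥ x = 0 := hx
    exact hc x (congrFun hx 0) (congrFun hx 1) (congrFun hx 2))
  have h2 := U.mulVecLin.finrank_range_add_finrank_ker
  have h3 := Submodule.finrank_le U.mulVecLin.range
  rw [Module.finrank_fintype_fun_eq_card] at h2 h3
  rw [Fintype.card_fin] at h3
  omega

lemma IndefinitePair.symm {A B : Matrix n n ℝ} (h : IndefinitePair A B) : IndefinitePair B A :=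
  fun a b hab => (h b a fun x => (add_comm _ _).trans_ge (hab x)).symm

lemma IndefinitePair.combination {A B : Matrix n n ℝ} (h : IndefinitePair A B) {α β : ℝ}
    (hα : α ≠ 0) : IndefinitePair (α • A + β • B) B := by
  intro a b hab
  obtain ⟨h1, h2⟩ := h (a * α) (a * β + b) fun x => by
    have := hab x
    simp only [add_mulVec, smul_mulVec, dotProduct_add, dotProduct_smul, smul_eq_mul] at this
    linarith
  have ha : a = 0 := (mul_eq_zero.mp h1).resolve_right hα
  exact ⟨ha, by simpa [ha] using h2⟩

lemma IndefinitePair.exists_pos {A B : Matrix n n ℝ} (h : IndefinitePair A B) :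
    ∃ x, 0 < x ⬝ᵥ A *ᵥ x := by
  by_contra! hc
  have := (h (-1) 0 fun x => by linarith [hc x]).1
  norm_num at this

lemma IndefinitePair.exists_neg {A B : Matrix n n ℝ} (h : IndefinitePair A B) :
    ∃ x, x ⬝ᵥ A *ᵥ x < 0 := by
  by_contra! hc
  have := (h 1 0 fun x => by linarith [hc x]).1
  norm_num at this

lemma IndefinitePair.exists_null_neg {A B : Matrix n n ℝ} (hA : A.IsSymm) (hB : B.IsSymm)
    (h : IndefinitePair A B) : ∃ x, x ⬝ᵥ A *ᵥ x = 0 ∧ x ⬝ᵥ B *ᵥ x < 0 := by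
  obtain ⟨x, hx⟩ := h.exists_pos
  obtain ⟨y, hy⟩ := h.exists_neg
  by_contra! hc
  obtain ⟨t, ht⟩ := exists_nonneg_combination hA hB hx hy hc
  have := (h t 1 fun x => by linarith [ht x]).2
  norm_num at this

lemma IndefinitePair.neg_right {A B : Matrix n n ℝ} (h : IndefinitePair A B) :
    IndefinitePair A (-B) := by
  intro a b hab
  have := h a (-b) fun x => by
    have := hab x
    rw [neg_mulVec, dotProduct_neg] at this
    linarith
  simpa using this

lemma IndefinitePair.exists_null_pos {A B : Matrix n n ℝ} (hA : A.IsSymm) (hB : B.IsSymm)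
    (h : IndefinitePair A B) : ∃ x, x ⬝ᵥ A *ᵥ x = 0 ∧ 0 < x ⬝ᵥ B *ᵥ x := by
  obtain ⟨x, hx, hx'⟩ := h.neg_right.exists_null_neg hA hB.neg
  rw [neg_mulVec, dotProduct_neg] at hx'
  exact ⟨x, hx, by linarith⟩

/-- An indefinite pair has a common zero outside its joint radical. -/
lemma IndefinitePair.exists_common_zero {A B : Matrix n n ℝ} (hA : A.IsSymm) (hB : B.IsSymm)
    (h : IndefinitePair A B) (hB3 : NonvanishingOnCodimThree B) :
    ∃ z, z ⬝ᵥ A *ᵥ z = 0 ∧ z ⬝ᵥ B *ᵥ z = 0 ∧ B *ᵥ z ≠ 0 := by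
  obtain ⟨p, hpA, hpB⟩ := h.exists_null_pos hA hB
  obtain ⟨q, hqA, hqB⟩ := h.exists_null_neg hA hB
  by_cases ha : p ⬝ᵥ A *ᵥ q = 0
  · obtain ⟨s, -, -, -, hs, -⟩ := exists_roots_of_pos_of_neg hpB hqB (p ⬝ᵥ B *ᵥ q)
    refine ⟨p + s • q, ?_, by rw [hB.quadForm_add_smul, hs], mulVec_add_smul_ne_zero hB hpB hqB s⟩
    rw [hA.quadForm_add_smul, hpA, hqA, ha]
    ring
  · obtain ⟨w, hw1, hw2, -, hw⟩ := hB3 (B *ᵥ p) (B *ᵥ q) 0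
    rw [dotProduct_comm] at hw1 hw2
    obtain ⟨x, y, h1, h2⟩ := exists_common_zero_of_conics (mul_ne_zero two_ne_zero ha) hpB
      (neg_pos.mpr hqB) (2 * (p ⬝ᵥ A *ᵥ w)) (2 * (q ⬝ᵥ A *ᵥ w)) (w ⬝ᵥ A *ᵥ w)
      (2 * (p ⬝ᵥ B *ᵥ q)) 0 0 (w ⬝ᵥ B *ᵥ w)
    refine ⟨x • p + y • q + (1 : ℝ) • w, ?_, ?_, fun h0 => hw ?_⟩
    · rw [hA.quadForm_add_add, hpA, hqA]
      linear_combination h1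
    · rw [hB.quadForm_add_add, hB.dotProduct_mulVec_swap p w, hB.dotProduct_mulVec_swap q w,
        hw1, hw2]
      linear_combination h2
    · have : w ⬝ᵥ B *ᵥ (x • p + y • q + (1 : ℝ) • w) = 0 := by rw [h0, dotProduct_zero]
      simpa [mulVec_add, mulVec_smul, dotProduct_add, dotProduct_smul, hw1, hw2] using this

lemma IndefinitePair.exists_regular_of_singular {F G : Matrix n n ℝ} (hF : F.IsSymm)
    (hG : G.IsSymm) (h : IndefinitePair F G) {z : n → ℝ} (hFz : F *ᵥ z = 0) (hGz : G *ᵥ z ≠ 0)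
    (hz : z ⬝ᵥ G *ᵥ z = 0) :
    ∃ x, x ⬝ᵥ F *ᵥ x = 0 ∧ x ⬝ᵥ G *ᵥ x = 0 ∧ LinearIndependent ℝ ![F *ᵥ x, G *ᵥ x] := by
  obtain ⟨a, ha⟩ := h.exists_pos
  obtain ⟨b, hb⟩ := h.exists_neg
  obtain ⟨x, hx, hFx, hqx⟩ : ∃ x, x ⬝ᵥ F *ᵥ x = 0 ∧ F *ᵥ x ≠ 0 ∧ G *ᵥ z ⬝ᵥ x ≠ 0 := by
    by_contra! hc
    exact hGz (dotProduct_self_eq_zero.mp (dotProduct_eq_zero_of_null hF ⊤ Submodule.mem_top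
      Submodule.mem_top ha hb (fun x _ => hc x) _ Submodule.mem_top))
  have hzF : ∀ y, z ⬝ᵥ F *ᵥ y = 0 := fun y => by
    rw [hF.dotProduct_mulVec_swap, hFz, dotProduct_zero]
  rw [dotProduct_comm, hG.dotProduct_mulVec_swap] at hqx
  by_cases hGx : x ⬝ᵥ G *ᵥ x = 0
  · refine ⟨x, hx, hGx, LinearIndependent.pair_iff.mpr fun s t hst => ?_⟩
    have h1 : z ⬝ᵥ (s • F *ᵥ x + t • G *ᵥ x) = 0 := by rw [hst, dotProduct_zero]
    rw [dotProduct_add, dotProduct_smul, dotProduct_smul, hzF, smul_zero, zero_add,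
      smul_eq_mul] at h1
    have ht := (mul_eq_zero.mp h1).resolve_right hqx
    rw [ht, zero_smul, add_zero] at hst
    exact ⟨(smul_eq_zero.mp hst).resolve_right hFx, ht⟩
  · set r := -2 * (z ⬝ᵥ G *ᵥ x) / (x ⬝ᵥ G *ᵥ x) with hr
    have hr0 : r ≠ 0 := div_ne_zero (mul_ne_zero (by norm_num) hqx) hGx
    have hrx : r * (x ⬝ᵥ G *ᵥ x) = -2 * (z ⬝ᵥ G *ᵥ x) := by rw [hr]; field_simp
    refine ⟨z + r • x, ?_, ?_, LinearIndependent.pair_iff.mpr fun s t hst => ?_⟩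
    · rw [hF.quadForm_add_smul, hzF, hzF, hx]
      ring
    · rw [hG.quadForm_add_smul, hz]
      linear_combination r * hrx
    · have h1 : z ⬝ᵥ (s • F *ᵥ (z + r • x) + t • G *ᵥ (z + r • x)) = 0 := by
        rw [hst, dotProduct_zero]
      rw [dotProduct_add, dotProduct_smul, dotProduct_smul, hzF, smul_zero, zero_add, mulVec_add,
        dotProduct_add, hz, zero_add, mulVec_smul, dotProduct_smul, smul_eq_mul, smul_eq_mul] at h1
      have ht := (mul_eq_zero.mp h1).resolve_right (mul_ne_zero hr0 hqx)
      rw [ht, zero_smul, add_zero, mulVec_add, hFz, zero_add, mulVec_smul, smul_smul] at hst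
      exact ⟨(mul_eq_zero.mp ((smul_eq_zero.mp hst).resolve_right hFx)).resolve_right hr0, ht⟩

/-- An indefinite pair has a common zero at which the gradients are linearly independent. -/
lemma IndefinitePair.exists_regular {A B : Matrix n n ℝ} (hA : A.IsSymm) (hB : B.IsSymm)
    (h : IndefinitePair A B) (hB3 : NonvanishingOnCodimThree B) :
    ∃ x, x ⬝ᵥ A *ᵥ x = 0 ∧ x ⬝ᵥ B *ᵥ x = 0 ∧ LinearIndependent ℝ ![A *ᵥ x, B *ᵥ x] := by
  obtain ⟨z, hzA, hzB, hBz⟩ := h.exists_common_zero hA hB hB3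
  by_cases hli : LinearIndependent ℝ ![A *ᵥ z, B *ᵥ z]
  · exact ⟨z, hzA, hzB, hli⟩
  obtain ⟨μ, hμ⟩ : ∃ μ : ℝ, A *ᵥ z + μ • B *ᵥ z = 0 := by
    by_contra! hc
    refine hli (LinearIndependent.pair_iff.mpr fun s t hst => ?_)
    have hs : s = 0 := by
      by_contra hs
      apply hc (t / s)
      rw [← smul_right_injective _ hs |>.eq_iff, smul_add, smul_smul, smul_zero,
        mul_div_cancel₀ _ hs, hst]
    rw [hs, zero_smul, zero_add] at hst
    exact ⟨hs, (smul_eq_zero.mp hst).resolve_right hBz⟩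
  have hF : ((1 : ℝ) • A + μ • B).IsSymm := (hA.smul 1).add (hB.smul μ)
  obtain ⟨x, h1, h2, h3⟩ := (h.combination (β := μ) one_ne_zero).exists_regular_of_singular hF hB
    (z := z) (by rw [add_mulVec, smul_mulVec, smul_mulVec, one_smul, hμ]) hBz hzB
  rw [add_mulVec, smul_mulVec, smul_mulVec, one_smul] at h1 h3
  refine ⟨x, ?_, h2, LinearIndependent.pair_iff.mpr fun s t hst => ?_⟩
  · rwa [dotProduct_add, dotProduct_smul, h2, smul_zero, add_zero] at h1
  · obtain ⟨e1, e2⟩ := LinearIndependent.pair_iff.mp h3 s (t - s * μ) (by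
      rw [← hst]
      module)
    exact ⟨e1, by rw [e1] at e2; linarith⟩

/-- Two linearly independent vectors have a dual pair. -/
lemma exists_dual_pair {a b : n → ℝ} (h : LinearIndependent ℝ ![a, b]) :
    ∃ u v : n → ℝ, a ⬝ᵥ u = 1 ∧ b ⬝ᵥ u = 0 ∧ a ⬝ᵥ v = 0 ∧ b ⬝ᵥ v = 1 := by
  rw [LinearIndependent.pair_iff] at h
  have hab := dotProduct_comm b a
  have hD : (a ⬝ᵥ a) * (b ⬝ᵥ b) - (a ⬝ᵥ b) ^ 2 ≠ 0 := by
    intro hD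
    have h1 : (b ⬝ᵥ b) • a + (-(a ⬝ᵥ b)) • b = 0 := by
      apply dotProduct_self_eq_zero.mp
      simp only [dotProduct_add, add_dotProduct, smul_dotProduct, dotProduct_smul, smul_eq_mul]
      rw [hab]
      linear_combination (b ⬝ᵥ b) * hD
    have h2 : b = 0 := dotProduct_self_eq_zero.mp (h _ _ h1).1
    have := (h 0 1 (by simp [h2])).2
    norm_num at this
  set D := (a ⬝ᵥ a) * (b ⬝ᵥ b) - (a ⬝ᵥ b) ^ 2 with hDdef
  refine ⟨D⁻¹ • ((b ⬝ᵥ b) • a - (a ⬝ᵥ b) • b), D⁻¹ • ((a ⬝ᵥ a) • b - (a ⬝ᵥ b) • a), ?_, ?_, ?_, ?_⟩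
  all_goals
    simp only [dotProduct_sub, dotProduct_smul, smul_eq_mul]
    rw [inv_mul_eq_iff_eq_mul₀ hD, hDdef]
    try rw [hab]
    ring

end QuadraticPairs

section ImplicitCurve

open Filter Topology

/-- The solution curve of two equations whose linear parts at the origin are the last two
coordinates is tangent to the first coordinate axis. -/
lemma exists_implicit_curve {g h : ℝ × ℝ × ℝ → ℝ}
    (hg : HasStrictFDerivAt g ((ContinuousLinearMap.fst ℝ ℝ ℝ).comp
      (ContinuousLinearMap.snd ℝ ℝ (ℝ × ℝ))) 0)
    (hh : HasStrictFDerivAt h ((ContinuousLinearMap.snd ℝ ℝ ℝ).comp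
      (ContinuousLinearMap.snd ℝ ℝ (ℝ × ℝ))) 0)
    (hg0 : g 0 = 0) (hh0 : h 0 = 0) {U : Set (ℝ × ℝ × ℝ)} (hU : U ∈ 𝓝 0) :
    ∃ (a b : ℝ → ℝ) (ε : ℝ), 0 < ε ∧ a 0 = 0 ∧ b 0 = 0 ∧
      ContinuousOn a (Set.Ioo (-ε) ε) ∧ ContinuousOn b (Set.Ioo (-ε) ε) ∧
      (∀ t ∈ Set.Ioo (-ε) ε, (t, a t, b t) ∈ U ∧ g (t, a t, b t) = 0 ∧ h (t, a t, b t) = 0) ∧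
      Tendsto (fun t => a t / t) (𝓝[≠] 0) (𝓝 0) ∧
      Tendsto (fun t => b t / t) (𝓝[≠] 0) (𝓝 0) := by
  let Φ : ℝ × ℝ × ℝ → ℝ × ℝ × ℝ := fun x => (x.1, g x, h x)
  have hΦ : HasStrictFDerivAt Φ
      ((ContinuousLinearEquiv.refl ℝ (ℝ × ℝ × ℝ) : (ℝ × ℝ × ℝ) ≃L[ℝ] (ℝ × ℝ × ℝ)) :
        (ℝ × ℝ × ℝ) →L[ℝ] (ℝ × ℝ × ℝ)) 0 := by
    have h1 : HasStrictFDerivAt (fun x : ℝ × ℝ × ℝ => x.1)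
        (ContinuousLinearMap.fst ℝ ℝ (ℝ × ℝ)) 0 := hasStrictFDerivAt_fst
    exact (h1.prodMk (hg.prodMk hh)).congr_fderiv (by ext <;> simp)
  have hΦ0 : Φ 0 = 0 := by simp [Φ, hg0, hh0]
  set e := hΦ.toOpenPartialHomeomorph Φ with he
  have he0 : (0 : ℝ × ℝ × ℝ) ∈ e.target := by
    have := hΦ.image_mem_toOpenPartialHomeomorph_target
    rwa [hΦ0] at this
  have hes : e.symm 0 = 0 := by
    have := e.left_inv hΦ.mem_toOpenPartialHomeomorph_source
    rwa [he, hΦ.toOpenPartialHomeomorph_coe, hΦ0] at this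
  have hder : HasStrictFDerivAt e.symm
      ((ContinuousLinearEquiv.refl ℝ (ℝ × ℝ × ℝ) : (ℝ × ℝ × ℝ) ≃L[ℝ] (ℝ × ℝ × ℝ)) :
        (ℝ × ℝ × ℝ) →L[ℝ] (ℝ × ℝ × ℝ)) 0 := by
    have := hΦ.to_localInverse
    rw [hΦ0] at this
    exact this
  let ι : ℝ → ℝ × ℝ × ℝ := fun t => (t, 0, 0)
  have hι : Continuous ι := by fun_prop
  have hι0 : ι 0 = 0 := rfl
  have hV : ι ⁻¹' (e.target ∩ e.symm ⁻¹' U) ∈ 𝓝 (0 : ℝ) := by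
    apply hι.continuousAt.preimage_mem_nhds
    rw [hι0]
    refine inter_mem (e.open_target.mem_nhds he0) ?_
    apply (e.continuousAt_symm he0).preimage_mem_nhds
    rwa [hes]
  obtain ⟨ε, hε, hball⟩ := Metric.mem_nhds_iff.mp hV
  rw [Real.ball_eq_Ioo, zero_sub, zero_add] at hball
  have hcont : ContinuousOn (fun t => e.symm (ι t)) (Set.Ioo (-ε) ε) :=
    e.continuousOn_symm.comp hι.continuousOn fun t ht => (hball ht).1
  have hdι : HasDerivAt ι (1, 0, 0) 0 :=
    (hasDerivAt_id (0 : ℝ)).prodMk ((hasDerivAt_const 0 0).prodMk (hasDerivAt_const 0 0))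
  have hd : HasDerivAt (fun t => e.symm (ι t)) (1, 0, 0) 0 := by
    have h1 : HasFDerivAt e.symm ((ContinuousLinearEquiv.refl ℝ (ℝ × ℝ × ℝ) :
        (ℝ × ℝ × ℝ) ≃L[ℝ] (ℝ × ℝ × ℝ)) : (ℝ × ℝ × ℝ) →L[ℝ] (ℝ × ℝ × ℝ)) (ι 0) :=
      hder.hasFDerivAt
    exact h1.comp_hasDerivAt (0 : ℝ) hdι
  have tends : ∀ f : ℝ → ℝ, HasDerivAt f 0 0 → f 0 = 0 →
      Tendsto (fun t => f t / t) (𝓝[≠] 0) (𝓝 0) := by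
    intro f hf hf0
    refine (hasDerivAt_iff_tendsto_slope.mp hf).congr fun t => ?_
    rw [slope_def_field, hf0, sub_zero, sub_zero]
  have ha0 : (e.symm (ι 0)).2.1 = 0 := by rw [hι0, hes]; rfl
  have hb0 : (e.symm (ι 0)).2.2 = 0 := by rw [hι0, hes]; rfl
  refine ⟨fun t => (e.symm (ι t)).2.1, fun t => (e.symm (ι t)).2.2, ε, hε, ha0, hb0,
    continuous_snd.fst.comp_continuousOn hcont, continuous_snd.snd.comp_continuousOn hcont,
    fun t ht => ?_, tends _ hd.snd.fst ha0, tends _ hd.snd.snd hb0⟩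
  have hr : Φ (e.symm (ι t)) = ι t := e.right_inv (hball ht).1
  have h1 : (e.symm (ι t)).1 = t := congrArg Prod.fst hr
  have h2 : (t, (e.symm (ι t)).2.1, (e.symm (ι t)).2.2) = e.symm (ι t) := by
    ext
    · exact h1.symm
    · rfl
    · rfl
  rw [h2]
  exact ⟨(hball ht).2, congrArg (fun x => x.2.1) hr, congrArg (fun x => x.2.2) hr⟩

lemma hasStrictFDerivAt_quadratic (c₁ c₂ c₃ c₄ c₅ c₆ : ℝ) {f : ℝ × ℝ × ℝ → ℝ}
    {f' : (ℝ × ℝ × ℝ) →L[ℝ] ℝ} (hf : HasStrictFDerivAt f f' 0) :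
    HasStrictFDerivAt (fun x : ℝ × ℝ × ℝ => f x + (c₁ * (x.1 * x.1) + c₂ * (x.2.1 * x.2.1) +
      c₃ * (x.2.2 * x.2.2) + c₄ * (x.1 * x.2.1) + c₅ * (x.1 * x.2.2) + c₆ * (x.2.1 * x.2.2)))
      f' 0 := by
  have h1 : HasStrictFDerivAt (fun x : ℝ × ℝ × ℝ => x.1)
      (ContinuousLinearMap.fst ℝ ℝ (ℝ × ℝ)) 0 := hasStrictFDerivAt_fst
  have h23 : HasStrictFDerivAt (fun x : ℝ × ℝ × ℝ => x.2)
      (ContinuousLinearMap.snd ℝ ℝ (ℝ × ℝ)) 0 := hasStrictFDerivAt_snd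
  have h2 := h23.fst
  have h3 := h23.snd
  refine (hf.add (((((((h1.mul h1).const_mul c₁).add ((h2.mul h2).const_mul c₂)).add
    ((h3.mul h3).const_mul c₃)).add ((h1.mul h2).const_mul c₄)).add
    ((h1.mul h3).const_mul c₅)).add ((h2.mul h3).const_mul c₆))).congr_fderiv ?_
  simp

end ImplicitCurve

section RegularZeros

open Filter Topology

variable {n : Type*} [Fintype n]

lemma Matrix.IsSymm.mulVec_dotProduct {G : Matrix n n ℝ} (hG : G.IsSymm) (x y : n → ℝ) :
    G *ᵥ x ⬝ᵥ y = x ⬝ᵥ G *ᵥ y := by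
  rw [dotProduct_comm, hG.dotProduct_mulVec_swap]

/-- The common zeros of the quadratic forms of `A` and `B` at which the gradients are linearly
independent. -/
def regularZeros (A B : Matrix n n ℝ) : Set (n → ℝ) :=
  {z | z ⬝ᵥ A *ᵥ z = 0 ∧ z ⬝ᵥ B *ᵥ z = 0 ∧ LinearIndependent ℝ ![A *ᵥ z, B *ᵥ z]}

lemma exists_curve_in_component {A B : Matrix n n ℝ} (hA : A.IsSymm) (hB : B.IsSymm)
    {z u v w : n → ℝ} (hz : z ∈ regularZeros A B)
    (hAu : z ⬝ᵥ A *ᵥ u = 1) (hBu : z ⬝ᵥ B *ᵥ u = 0) (hAv : z ⬝ᵥ A *ᵥ v = 0)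
    (hBv : z ⬝ᵥ B *ᵥ v = 1) (hAw : z ⬝ᵥ A *ᵥ w = 0) (hBw : z ⬝ᵥ B *ᵥ w = 0) :
    ∃ c e : ℝ → ℝ, Tendsto c (𝓝[≠] 0) (𝓝 0) ∧ Tendsto e (𝓝[≠] 0) (𝓝 0) ∧
      ∀ᶠ t in 𝓝[≠] (0 : ℝ), z + t • ((1 : ℝ) • w + c t • u + e t • v) ∈
        connectedComponentIn (regularZeros A B) z := by
  let y : ℝ × ℝ × ℝ → n → ℝ := fun x => z + (1 : ℝ) • (x.1 • w + x.2.1 • u + x.2.2 • v)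
  have hy : Continuous y := by fun_prop
  have hy0 : y 0 = z := by simp [y]
  let δ : (n → ℝ) → ℝ := fun x => (A *ᵥ x ⬝ᵥ u) * (B *ᵥ x ⬝ᵥ v) - (A *ᵥ x ⬝ᵥ v) * (B *ᵥ x ⬝ᵥ u)
  have hδ : Continuous δ := by
    have hc : ∀ (M : Matrix n n ℝ) (q : n → ℝ), Continuous fun x : n → ℝ => M *ᵥ x ⬝ᵥ q :=
      fun M q => (continuous_const.matrix_mulVec continuous_id).dotProduct continuous_const
    exact ((hc A u).mul (hc B v)).sub ((hc A v).mul (hc B u))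
  have hU : {x | δ (y x) ≠ 0} ∈ 𝓝 (0 : ℝ × ℝ × ℝ) := by
    apply (isOpen_ne_fun (hδ.comp hy) continuous_const).mem_nhds
    simp [hy0, δ, hA.mulVec_dotProduct, hB.mulVec_dotProduct, hAu, hBu, hAv, hBv]
  obtain ⟨a, b, ε, hε, ha0, hb0, ha, hb, hab, hta, htb⟩ := exists_implicit_curve
    (hasStrictFDerivAt_quadratic (w ⬝ᵥ A *ᵥ w / 2) (u ⬝ᵥ A *ᵥ u / 2) (v ⬝ᵥ A *ᵥ v / 2)
      (w ⬝ᵥ A *ᵥ u) (w ⬝ᵥ A *ᵥ v) (u ⬝ᵥ A *ᵥ v)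
      (ContinuousLinearMap.hasStrictFDerivAt _))
    (hasStrictFDerivAt_quadratic (w ⬝ᵥ B *ᵥ w / 2) (u ⬝ᵥ B *ᵥ u / 2) (v ⬝ᵥ B *ᵥ v / 2)
      (w ⬝ᵥ B *ᵥ u) (w ⬝ᵥ B *ᵥ v) (u ⬝ᵥ B *ᵥ v)
      (ContinuousLinearMap.hasStrictFDerivAt _)) (by simp) (by simp) hU
  have hmem : ∀ t ∈ Set.Ioo (-ε) ε, y (t, a t, b t) ∈ regularZeros A B := by
    intro t ht
    obtain ⟨h1, h2, h3⟩ := hab t ht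
    refine ⟨?_, ?_, LinearIndependent.pair_iff.mpr fun r s hrs => ?_⟩
    · rw [hA.quadForm_add_smul, hA.quadForm_add_add, hz.1]
      simp only [mulVec_add, mulVec_smul, dotProduct_add, dotProduct_smul, smul_eq_mul,
        hAu, hAv, hAw]
      simp at h2
      linear_combination 2 * h2
    · rw [hB.quadForm_add_smul, hB.quadForm_add_add, hz.2.1]
      simp only [mulVec_add, mulVec_smul, dotProduct_add, dotProduct_smul, smul_eq_mul,
        hBu, hBv, hBw]
      simp at h3
      linear_combination 2 * h3
    · have e1 := congrArg (· ⬝ᵥ u) hrs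
      have e2 := congrArg (· ⬝ᵥ v) hrs
      simp only [add_dotProduct, smul_dotProduct, smul_eq_mul, zero_dotProduct] at e1 e2
      have h1' : δ (y (t, a t, b t)) ≠ 0 := h1
      constructor
      · refine (mul_eq_zero.mp (?_ : r * δ (y (t, a t, b t)) = 0)).resolve_right h1'
        linear_combination (B *ᵥ y (t, a t, b t) ⬝ᵥ v) * e1 - (B *ᵥ y (t, a t, b t) ⬝ᵥ u) * e2
      · refine (mul_eq_zero.mp (?_ : s * δ (y (t, a t, b t)) = 0)).resolve_right h1'
        linear_combination (A *ᵥ y (t, a t, b t) ⬝ᵥ u) * e2 - (A *ᵥ y (t, a t, b t) ⬝ᵥ v) * e1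
  have hcomp : ∀ t ∈ Set.Ioo (-ε) ε, y (t, a t, b t) ∈
      connectedComponentIn (regularZeros A B) z := by
    have hc : ContinuousOn (fun t => y (t, a t, b t)) (Set.Ioo (-ε) ε) :=
      hy.comp_continuousOn (continuousOn_id.prodMk (ha.prodMk hb))
    have hpre := isPreconnected_Ioo.image _ hc
    have hsub := hpre.subset_connectedComponentIn (x := z) (F := regularZeros A B)
      ⟨0, ⟨by linarith, hε⟩, by
        change y (0, a 0, b 0) = z
        rw [ha0, hb0]
        exact hy0⟩
      (by rintro _ ⟨t, ht, rfl⟩; exact hmem t ht)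
    exact fun t ht => hsub ⟨t, ht, rfl⟩
  refine ⟨_, _, hta, htb, ?_⟩
  filter_upwards [nhdsWithin_le_nhds (Ioo_mem_nhds (neg_lt_zero.mpr hε) hε),
    self_mem_nhdsWithin] with t ht ht0
  convert hcomp t ht using 1
  have ht0 : t ≠ 0 := ht0
  simp only [y, smul_add, smul_smul, one_mul, mul_one]
  rw [mul_div_cancel₀ _ ht0, mul_div_cancel₀ _ ht0]

/-- If a component of the regular zeros lies in the hyperplane orthogonal to `p`, then some
combination of the two forms vanishes on this hyperplane. -/
lemma exists_combination_isotropic {A B : Matrix n n ℝ} (hA : A.IsSymm) (hB : B.IsSymm)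
    (hB3 : NonvanishingOnCodimThree B) {z p : n → ℝ} (hz : z ∈ regularZeros A B) (hp : p ≠ 0)
    (hcomp : ∀ x ∈ connectedComponentIn (regularZeros A B) z, p ⬝ᵥ x = 0) :
    ∃ α β : ℝ, α ≠ 0 ∧ ∀ x, p ⬝ᵥ x = 0 → x ⬝ᵥ (α • A + β • B) *ᵥ x = 0 := by
  obtain ⟨u, v, hAu, hBu, hAv, hBv⟩ := exists_dual_pair hz.2.2
  rw [hA.mulVec_dotProduct] at hAu hAv
  rw [hB.mulVec_dotProduct] at hBu hBv
  have hpz : p ⬝ᵥ z = 0 := hcomp z (mem_connectedComponentIn hz)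
  set α := p ⬝ᵥ u with hα
  set β := p ⬝ᵥ v with hβ
  have curve : ∀ w, z ⬝ᵥ A *ᵥ w = 0 → z ⬝ᵥ B *ᵥ w = 0 → ∃ c e : ℝ → ℝ,
      Tendsto c (𝓝[≠] 0) (𝓝 0) ∧ Tendsto e (𝓝[≠] 0) (𝓝 0) ∧
      ∀ᶠ t in 𝓝[≠] (0 : ℝ), t ≠ 0 ∧ p ⬝ᵥ w + c t * α + e t * β = 0 ∧
        2 * c t + t * (((1 : ℝ) • w + c t • u + e t • v) ⬝ᵥ A *ᵥ
          ((1 : ℝ) • w + c t • u + e t • v)) = 0 ∧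
        2 * e t + t * (((1 : ℝ) • w + c t • u + e t • v) ⬝ᵥ B *ᵥ
          ((1 : ℝ) • w + c t • u + e t • v)) = 0 := by
    intro w hAw hBw
    obtain ⟨c, e, hc, he, hce⟩ := exists_curve_in_component hA hB hz hAu hBu hAv hBv hAw hBw
    refine ⟨c, e, hc, he, ?_⟩
    filter_upwards [hce, self_mem_nhdsWithin] with t ht ht0
    have ht0 : t ≠ 0 := ht0
    obtain ⟨h1, h2, -⟩ := connectedComponentIn_subset _ _ ht
    have h3 := hcomp _ ht
    refine ⟨ht0, ?_, ?_, ?_⟩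
    · simp only [dotProduct_add, dotProduct_smul, smul_eq_mul, hpz, one_mul, zero_add] at h3
      exact (mul_eq_zero.mp h3).resolve_left ht0
    · rw [hA.quadForm_add_smul, hz.1, mulVec_add, mulVec_add, mulVec_smul, mulVec_smul,
        mulVec_smul, dotProduct_add, dotProduct_add, dotProduct_smul, dotProduct_smul,
        dotProduct_smul, hAu, hAv, hAw, ← mulVec_smul, ← mulVec_smul, ← mulVec_smul,
        ← mulVec_add, ← mulVec_add] at h1
      simp only [smul_eq_mul] at h1
      apply mul_left_cancel₀ ht0
      linear_combination h1
    · rw [hB.quadForm_add_smul, hz.2.1, mulVec_add, mulVec_add, mulVec_smul, mulVec_smul,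
        mulVec_smul, dotProduct_add, dotProduct_add, dotProduct_smul, dotProduct_smul,
        dotProduct_smul, hBu, hBv, hBw, ← mulVec_smul, ← mulVec_smul, ← mulVec_smul,
        ← mulVec_add, ← mulVec_add] at h2
      simp only [smul_eq_mul] at h2
      apply mul_left_cancel₀ ht0
      linear_combination h2
  have hpT : ∀ w, z ⬝ᵥ A *ᵥ w = 0 → z ⬝ᵥ B *ᵥ w = 0 → p ⬝ᵥ w = 0 := by
    intro w hAw hBw
    obtain ⟨c, e, hc, he, hce⟩ := curve w hAw hBw
    have h1 : Tendsto (fun t => p ⬝ᵥ w + c t * α + e t * β) (𝓝[≠] 0)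
        (𝓝 (p ⬝ᵥ w + 0 * α + 0 * β)) :=
      (tendsto_const_nhds.add (hc.mul_const α)).add (he.mul_const β)
    have h2 := tendsto_nhds_unique (h1.congr' (hce.mono fun t ht => ht.2.1)) tendsto_const_nhds
    simpa using h2
  have hpx : ∀ x, p ⬝ᵥ x = (z ⬝ᵥ A *ᵥ x) * α + (z ⬝ᵥ B *ᵥ x) * β := by
    intro x
    have := hpT (x - (z ⬝ᵥ A *ᵥ x) • u - (z ⬝ᵥ B *ᵥ x) • v)
      (by simp [mulVec_sub, mulVec_smul, dotProduct_sub, dotProduct_smul, hAu, hAv])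
      (by simp [mulVec_sub, mulVec_smul, dotProduct_sub, dotProduct_smul, hBu, hBv])
    simp only [dotProduct_sub, dotProduct_smul, smul_eq_mul] at this
    linarith
  have hF : (α • A + β • B).IsSymm := (hA.smul α).add (hB.smul β)
  have hFq : ∀ x y, x ⬝ᵥ (α • A + β • B) *ᵥ y = α * (x ⬝ᵥ A *ᵥ y) + β * (x ⬝ᵥ B *ᵥ y) := by
    intro x y
    simp [add_mulVec, smul_mulVec, dotProduct_add, dotProduct_smul]
  set F := α • A + β • B
  have curveF : ∀ w, z ⬝ᵥ A *ᵥ w = 0 → z ⬝ᵥ B *ᵥ w = 0 → ∃ c e : ℝ → ℝ,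
      Tendsto c (𝓝[≠] 0) (𝓝 0) ∧ Tendsto e (𝓝[≠] 0) (𝓝 0) ∧
      ∀ᶠ t in 𝓝[≠] (0 : ℝ), t ≠ 0 ∧ c t * α + e t * β = 0 ∧
        2 * e t + t * (((1 : ℝ) • w + c t • u + e t • v) ⬝ᵥ B *ᵥ
          ((1 : ℝ) • w + c t • u + e t • v)) = 0 ∧
        ((1 : ℝ) • w + c t • u + e t • v) ⬝ᵥ F *ᵥ ((1 : ℝ) • w + c t • u + e t • v) = 0 := by
    intro w hAw hBw
    obtain ⟨c, e, hc, he, hce⟩ := curve w hAw hBw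
    refine ⟨c, e, hc, he, hce.mono fun t ⟨ht0, h1, h2, h3⟩ => ?_⟩
    rw [hpT w hAw hBw, zero_add] at h1
    refine ⟨ht0, h1, h3, ?_⟩
    rw [hFq]
    apply mul_left_cancel₀ ht0
    linear_combination α * h2 + β * h3 - 2 * h1
  have hFT : ∀ w, z ⬝ᵥ A *ᵥ w = 0 → z ⬝ᵥ B *ᵥ w = 0 → w ⬝ᵥ F *ᵥ w = 0 := by
    intro w hAw hBw
    obtain ⟨c, e, hc, he, hce⟩ := curveF w hAw hBw
    have hcont : Continuous fun q : ℝ × ℝ => ((1 : ℝ) • w + q.1 • u + q.2 • v) ⬝ᵥ F *ᵥ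
        ((1 : ℝ) • w + q.1 • u + q.2 • v) := by
      simp only [hF.quadForm_add_add]
      fun_prop
    have h1 := (hcont.tendsto (0, 0)).comp (hc.prodMk_nhds he)
    have h2 := tendsto_nhds_unique (h1.congr' (hce.mono fun t ht => ht.2.2.2)) tendsto_const_nhds
    simpa using h2
  obtain ⟨w₀, hAw₀, hBw₀, -, hw₀⟩ := hB3 (A *ᵥ z) (B *ᵥ z) 0
  rw [hA.mulVec_dotProduct] at hAw₀
  rw [hB.mulVec_dotProduct] at hBw₀
  have hα0 : α ≠ 0 := by
    intro h0
    have h1 := hFT w₀ hAw₀ hBw₀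
    rw [hFq, h0, zero_mul, zero_add] at h1
    have hβ0 := (mul_eq_zero.mp h1).resolve_right hw₀
    apply hp
    apply dotProduct_self_eq_zero.mp
    rw [hpx, h0, hβ0]
    ring
  set u' := v - (β / α) • u with hu'
  have hAu' : z ⬝ᵥ A *ᵥ u' = -(β / α) := by
    simp [hu', mulVec_sub, mulVec_smul, dotProduct_sub, dotProduct_smul, hAu, hAv]
  have hBu' : z ⬝ᵥ B *ᵥ u' = 1 := by
    simp [hu', mulVec_sub, mulVec_smul, dotProduct_sub, dotProduct_smul, hBu, hBv]
  have step : ∀ w, z ⬝ᵥ A *ᵥ w = 0 → z ⬝ᵥ B *ᵥ w = 0 → w ⬝ᵥ B *ᵥ w ≠ 0 →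
      w ⬝ᵥ F *ᵥ u' = 0 ∧ u' ⬝ᵥ F *ᵥ u' = 0 := by
    intro w hAw hBw hw
    obtain ⟨c, e, hc, he, hce⟩ := curveF w hAw hBw
    have hev : ∀ᶠ t in 𝓝[≠] (0 : ℝ), e t ≠ 0 ∧
        2 * (w ⬝ᵥ F *ᵥ u') + e t * (u' ⬝ᵥ F *ᵥ u') = 0 := by
      filter_upwards [hce] with t ⟨ht0, h1, h2, h3⟩
      have hct : c t = -(β / α) * e t := by
        field_simp
        linarith
      have hX : (1 : ℝ) • w + c t • u + e t • v = w + e t • u' := by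
        rw [hct, hu']
        module
      rw [hX] at h2 h3
      have he0 : e t ≠ 0 := by
        intro h0
        rw [h0, zero_smul, add_zero, mul_zero, zero_add] at h2
        exact mul_ne_zero ht0 hw h2
      refine ⟨he0, ?_⟩
      rw [hF.quadForm_add_smul, hFT w hAw hBw] at h3
      apply mul_left_cancel₀ he0
      linear_combination h3
    have h1 : Tendsto (fun t => 2 * (w ⬝ᵥ F *ᵥ u') + e t * (u' ⬝ᵥ F *ᵥ u')) (𝓝[≠] 0)
        (𝓝 (2 * (w ⬝ᵥ F *ᵥ u') + 0 * (u' ⬝ᵥ F *ᵥ u'))) :=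
      tendsto_const_nhds.add (he.mul_const _)
    have h2 := tendsto_nhds_unique (h1.congr' (hev.mono fun t ht => ht.2)) tendsto_const_nhds
    have h3 : w ⬝ᵥ F *ᵥ u' = 0 := by linarith
    obtain ⟨t, ht1, ht2⟩ := hev.exists
    rw [h3, mul_zero, zero_add] at ht2
    exact ⟨h3, (mul_eq_zero.mp ht2).resolve_left ht1⟩
  obtain ⟨hw₀F, huF⟩ := step w₀ hAw₀ hBw₀ hw₀
  have hTu : ∀ w, z ⬝ᵥ A *ᵥ w = 0 → z ⬝ᵥ B *ᵥ w = 0 → w ⬝ᵥ F *ᵥ u' = 0 := by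
    intro w hAw hBw
    obtain ⟨s, hs⟩ : ∃ s : ℝ, (w + s • w₀) ⬝ᵥ B *ᵥ (w + s • w₀) ≠ 0 := by
      by_contra! hc
      have h0 := hc 0
      have h1 := hc 1
      have h2 := hc (-1)
      rw [hB.quadForm_add_smul] at h0 h1 h2
      exact hw₀ (by linarith)
    have := (step (w + s • w₀) (by simp [mulVec_add, mulVec_smul, hAw, hAw₀])
      (by simp [mulVec_add, mulVec_smul, hBw, hBw₀]) hs).1
    rwa [add_dotProduct, smul_dotProduct, hw₀F, smul_zero, add_zero] at this
  refine ⟨α, β, hα0, fun x hx => ?_⟩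
  rw [hpx] at hx
  have hAx : z ⬝ᵥ A *ᵥ x = -(β / α) * (z ⬝ᵥ B *ᵥ x) := by
    field_simp
    linarith
  set s := z ⬝ᵥ B *ᵥ x with hs
  have hAT : z ⬝ᵥ A *ᵥ (x - s • u') = 0 := by
    rw [mulVec_sub, mulVec_smul, dotProduct_sub, dotProduct_smul, hAu', hAx, smul_eq_mul]
    ring
  have hBT : z ⬝ᵥ B *ᵥ (x - s • u') = 0 := by
    rw [mulVec_sub, mulVec_smul, dotProduct_sub, dotProduct_smul, hBu', ← hs, smul_eq_mul]
    ring
  rw [show x = (x - s • u') + s • u' by module, hF.quadForm_add_smul, hFT _ hAT hBT,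
    hTu _ hAT hBT, huF]
  ring

end RegularZeros

section SplitPairs

variable {n : Type*} [Fintype n]

/-- The hyperplane (or the whole space) orthogonal to `p`. -/
def orthogonalHyperplane (p : n → ℝ) : Submodule ℝ (n → ℝ) where
  carrier := {x | p ⬝ᵥ x = 0}
  add_mem' {x y} hx hy := by
    change p ⬝ᵥ (x + y) = 0
    rw [dotProduct_add, show p ⬝ᵥ x = 0 from hx, show p ⬝ᵥ y = 0 from hy, add_zero]
  zero_mem' := dotProduct_zero p
  smul_mem' c x hx := by
    change p ⬝ᵥ (c • x) = 0
    rw [dotProduct_smul, show p ⬝ᵥ x = 0 from hx, smul_zero]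

lemma exists_eq_smul_of_dotProduct_eq_zero {k r : n → ℝ}
    (h : ∀ x, k ⬝ᵥ x = 0 → r ⬝ᵥ x = 0) : ∃ c : ℝ, r = c • k := by
  refine ⟨k ⬝ᵥ r / k ⬝ᵥ k, sub_eq_zero.mp (dotProduct_self_eq_zero.mp ?_)⟩
  have hk : k ⬝ᵥ (r - (k ⬝ᵥ r / k ⬝ᵥ k) • k) = 0 := by
    rw [dotProduct_sub, dotProduct_smul, smul_eq_mul]
    by_cases h0 : k ⬝ᵥ k = 0
    · rw [dotProduct_self_eq_zero.mp h0]
      simp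
    · rw [div_mul_cancel₀ _ h0, sub_self]
  rw [sub_dotProduct, h _ hk, smul_dotProduct, hk, smul_zero, sub_zero]

/-- On an indefinite hyperplane section, a product of two linear forms vanishes on the null cone
only if one of the factors vanishes identically. -/
lemma dotProduct_eq_zero_of_mul_eq_zero {B : Matrix n n ℝ} (hB : B.IsSymm)
    (hB3 : NonvanishingOnCodimThree B) {k p r : n → ℝ}
    (hpos : ∃ a, k ⬝ᵥ a = 0 ∧ 0 < a ⬝ᵥ B *ᵥ a) (hneg : ∃ b, k ⬝ᵥ b = 0 ∧ b ⬝ᵥ B *ᵥ b < 0)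
    (hp : ∃ x, k ⬝ᵥ x = 0 ∧ p ⬝ᵥ x ≠ 0)
    (h : ∀ x, k ⬝ᵥ x = 0 → x ⬝ᵥ B *ᵥ x = 0 → (p ⬝ᵥ x) * (r ⬝ᵥ x) = 0) :
    ∀ x, k ⬝ᵥ x = 0 → r ⬝ᵥ x = 0 := by
  obtain ⟨a, hka, ha⟩ := hpos
  obtain ⟨b, hkb, hb⟩ := hneg
  have key : ∀ q : n → ℝ, (∃ x, k ⬝ᵥ x = 0 ∧ q ⬝ᵥ x ≠ 0) →
      ∃ x, k ⬝ᵥ x = 0 ∧ x ⬝ᵥ B *ᵥ x = 0 ∧ q ⬝ᵥ x ≠ 0 := by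
    rintro q ⟨y, hky, hqy⟩
    by_contra! hc
    exact hqy (dotProduct_eq_zero_of_null hB (orthogonalHyperplane k) hka hkb ha hb
      (fun x hx hx0 _ => hc x hx hx0) y hky)
  by_contra! hr
  obtain ⟨x₁, hk₁, hn₁, hp₁⟩ := key p hp
  obtain ⟨x₂, hk₂, hn₂, hr₂⟩ := key r hr
  have hr₁ := (mul_eq_zero.mp (h x₁ hk₁ hn₁)).resolve_left hp₁
  have hp₂ := (mul_eq_zero.mp (h x₂ hk₂ hn₂)).resolve_right hr₂
  by_cases hm : x₁ ⬝ᵥ B *ᵥ x₂ = 0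
  · have h12 := h (x₁ + (1 : ℝ) • x₂) (by simp [dotProduct_add, hk₁, hk₂])
      (by rw [hB.quadForm_add_smul, hn₁, hn₂, hm]; ring)
    rw [one_smul, dotProduct_add, dotProduct_add, hp₂, hr₁, add_zero, zero_add] at h12
    exact mul_ne_zero hp₁ hr₂ h12
  obtain ⟨w, hkw, h1w, h2w, hw⟩ := hB3 k (B *ᵥ x₁) (B *ᵥ x₂)
  rw [hB.mulVec_dotProduct] at h1w h2w
  have hs : ∀ s : ℝ, s ≠ 0 → (s * (p ⬝ᵥ x₁) + p ⬝ᵥ w) *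
      (2 * s * (x₁ ⬝ᵥ B *ᵥ x₂) * (r ⬝ᵥ w) - (w ⬝ᵥ B *ᵥ w) * (r ⬝ᵥ x₂)) = 0 := by
    intro s hs0
    set ρ := -(w ⬝ᵥ B *ᵥ w) / (2 * s * (x₁ ⬝ᵥ B *ᵥ x₂)) with hρ
    have hρ' : 2 * s * (x₁ ⬝ᵥ B *ᵥ x₂) * ρ = -(w ⬝ᵥ B *ᵥ w) := by
      rw [hρ]
      field_simp
    have hx := h ((1 : ℝ) • w + s • x₁ + ρ • x₂)
      (by simp [dotProduct_add, hk₁, hk₂, hkw])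
      (by
        rw [hB.quadForm_add_add, hB.dotProduct_mulVec_swap w x₁, hB.dotProduct_mulVec_swap w x₂,
          h1w, h2w, hn₁, hn₂]
        linear_combination hρ')
    simp only [dotProduct_add, dotProduct_smul, smul_eq_mul, hp₂, hr₁] at hx
    linear_combination 2 * s * (x₁ ⬝ᵥ B *ᵥ x₂) * hx -
      (p ⬝ᵥ w + s * (p ⬝ᵥ x₁)) * (r ⬝ᵥ x₂) * hρ'
  have e1 := hs 1 one_ne_zero
  have e2 := hs (-1) (by norm_num)
  have e3 := hs 2 two_ne_zero
  have hrw : (x₁ ⬝ᵥ B *ᵥ x₂) * (p ⬝ᵥ x₁) * (r ⬝ᵥ w) = 0 := by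
    linear_combination e3 / 6 - e1 / 4 + e2 / 12
  have hrw := (mul_eq_zero.mp hrw).resolve_left (mul_ne_zero hm hp₁)
  rw [hrw] at e1 e2
  have : (p ⬝ᵥ x₁) * ((w ⬝ᵥ B *ᵥ w) * (r ⬝ᵥ x₂)) = 0 := by
    linear_combination (e2 - e1) / 2
  exact mul_ne_zero hp₁ (mul_ne_zero hw hr₂) this

/-- An indefinite pair of forms of which the first is the product of the linear forms `p` and `k`,
with Poisson bracket vanishing on the common zeros and with radical on which the form of `J` is
nondegenerate. -/
structure SplitPair [DecidableEq n] (J F B : Matrix n n ℝ) (p k : n → ℝ) : Prop where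
  symmF : F.IsSymm
  symmB : B.IsSymm
  mulVec_eq : ∀ x, F *ᵥ x = (k ⬝ᵥ x) • p + (p ⬝ᵥ x) • k
  indef : IndefinitePair F B
  codim : NonvanishingOnCodimThree B
  skew : Jᵀ = -J
  sq : J * J = -1
  vanish : ∀ x, x ⬝ᵥ F *ᵥ x = 0 → x ⬝ᵥ B *ᵥ x = 0 → x ⬝ᵥ B *ᵥ J *ᵥ F *ᵥ x = 0
  rad : ∀ v, F *ᵥ v = 0 → B *ᵥ v = 0 →
    (∀ w, F *ᵥ w = 0 → B *ᵥ w = 0 → v ⬝ᵥ J *ᵥ w = 0) → v = 0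

lemma dotProduct_mulVec_of_skew {J : Matrix n n ℝ} (hJ : Jᵀ = -J) (x y : n → ℝ) :
    x ⬝ᵥ J *ᵥ y = -(J *ᵥ x ⬝ᵥ y) := by
  rw [dotProduct_mulVec, ← mulVec_transpose, hJ, neg_mulVec, neg_dotProduct]

namespace SplitPair

variable [DecidableEq n] {J F B : Matrix n n ℝ} {p k : n → ℝ}

lemma swap (h : SplitPair J F B p k) : SplitPair J F B k p :=
  { h with mulVec_eq := fun x => by rw [h.mulVec_eq, add_comm] }

lemma neg (h : SplitPair J F B p k) : SplitPair J F (-B) p k :=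
  { h with
    symmB := h.symmB.neg
    indef := h.indef.neg_right
    codim := fun u₁ u₂ u₃ => by
      obtain ⟨w, h1, h2, h3, h4⟩ := h.codim u₁ u₂ u₃
      exact ⟨w, h1, h2, h3, by rwa [neg_mulVec, dotProduct_neg, neg_ne_zero]⟩
    vanish := fun x hF hB => by
      rw [neg_mulVec, dotProduct_neg, neg_eq_zero] at hB ⊢
      exact h.vanish x hF hB
    rad := fun v hF hB hv => by
      simp only [neg_mulVec, neg_eq_zero] at hB hv
      exact h.rad v hF hB hv }

lemma quadForm_eq (h : SplitPair J F B p k) (x : n → ℝ) :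
    x ⬝ᵥ F *ᵥ x = 2 * (k ⬝ᵥ x) * (p ⬝ᵥ x) := by
  rw [h.mulVec_eq, dotProduct_add, dotProduct_smul, dotProduct_smul, dotProduct_comm x p,
    dotProduct_comm x k, smul_eq_mul, smul_eq_mul]
  ring

lemma mulVec_mulVec_self (h : SplitPair J F B p k) (x : n → ℝ) : J *ᵥ J *ᵥ x = -x := by
  rw [mulVec_mulVec, h.sq, neg_mulVec, one_mulVec]

lemma exists_ne (h : SplitPair J F B p k) : ∃ x, k ⬝ᵥ x = 0 ∧ p ⬝ᵥ x ≠ 0 := by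
  by_contra! hc
  obtain ⟨c, rfl⟩ := exists_eq_smul_of_dotProduct_eq_zero hc
  have hq : ∀ x, x ⬝ᵥ F *ᵥ x = 2 * c * (k ⬝ᵥ x) ^ 2 := by
    intro x
    rw [h.quadForm_eq, smul_dotProduct, smul_eq_mul]
    ring
  rcases le_total 0 c with hc0 | hc0
  · have := (h.indef 1 0 fun x => by rw [hq]; nlinarith [mul_nonneg hc0 (sq_nonneg (k ⬝ᵥ x))]).1
    exact one_ne_zero this
  · have := (h.indef (-1) 0 fun x => by
      rw [hq]; nlinarith [mul_nonneg (neg_nonneg.mpr hc0) (sq_nonneg (k ⬝ᵥ x))]).1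
    norm_num at this

lemma dotProduct_eq_zero (h : SplitPair J F B p k) {w : n → ℝ} (hw : F *ᵥ w = 0) :
    k ⬝ᵥ w = 0 := by
  obtain ⟨x, hkx, hpx⟩ := h.exists_ne
  have := congrArg (x ⬝ᵥ ·) hw
  simp only [h.mulVec_eq, dotProduct_add, dotProduct_smul, dotProduct_comm x p,
    dotProduct_comm x k, hkx, smul_eq_mul, mul_zero, add_zero, dotProduct_zero] at this
  exact (mul_eq_zero.mp this).resolve_right hpx

lemma exists_eigen (h : SplitPair J F B p k) (hpos : ∃ a, k ⬝ᵥ a = 0 ∧ 0 < a ⬝ᵥ B *ᵥ a)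
    (hneg : ∃ b, k ⬝ᵥ b = 0 ∧ b ⬝ᵥ B *ᵥ b < 0) : ∃ c : ℝ, B *ᵥ J *ᵥ k = c • k := by
  apply exists_eq_smul_of_dotProduct_eq_zero
  apply dotProduct_eq_zero_of_mul_eq_zero h.symmB h.codim hpos hneg h.exists_ne
  intro x hk hx
  have := h.vanish x (by rw [h.quadForm_eq, hk]; ring) hx
  rw [h.mulVec_eq, hk, zero_smul, zero_add, mulVec_smul, mulVec_smul, dotProduct_smul,
    smul_eq_mul, dotProduct_comm x] at this
  exact this

lemma not_nonneg (h : SplitPair J F B p k) : ¬ ∀ x, p ⬝ᵥ x = 0 → 0 ≤ x ⬝ᵥ B *ᵥ x := by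
  intro hp
  have hneg : ∃ b, k ⬝ᵥ b = 0 ∧ b ⬝ᵥ B *ᵥ b < 0 := by
    obtain ⟨x, hFx, hBx⟩ := h.indef.exists_null_neg h.symmF h.symmB
    rw [h.quadForm_eq] at hFx
    rcases mul_eq_zero.mp hFx with h1 | h1
    · exact ⟨x, by linarith, hBx⟩
    · exact absurd (hp x h1) (not_le.mpr hBx)
  have hpos : ∃ a, k ⬝ᵥ a = 0 ∧ 0 < a ⬝ᵥ B *ᵥ a := by
    obtain ⟨w, h1, h2, -, h3⟩ := h.codim p k 0
    exact ⟨w, h2, lt_of_le_of_ne (hp w h1) h3.symm⟩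
  obtain ⟨c, hc⟩ := h.exists_eigen hpos hneg
  obtain ⟨x, hkx, hpx⟩ := h.exists_ne
  set v := J *ᵥ k with hv
  have hkv : k ⬝ᵥ v = 0 := by
    have := dotProduct_mulVec_of_skew h.skew k k
    rw [dotProduct_comm (J *ᵥ k)] at this
    linarith
  have hk0 : k ≠ 0 := by
    rintro rfl
    obtain ⟨y, hy0, hy⟩ := h.swap.exists_ne
    exact hy (zero_dotProduct y)
  have hFv : F *ᵥ v = (p ⬝ᵥ v) • k := by rw [h.mulVec_eq, hkv, zero_smul, zero_add]
  by_cases hpv : p ⬝ᵥ v = 0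
  · have hvB : v ⬝ᵥ B *ᵥ v = 0 := by
      rw [hc, dotProduct_smul, dotProduct_comm, hkv, smul_zero]
    obtain ⟨s, hs⟩ : ∃ s : ℝ, B *ᵥ v = s • p := by
      apply exists_eq_smul_of_dotProduct_eq_zero
      intro y hy
      rw [h.symmB.mulVec_dotProduct]
      by_contra hne
      set m := v ⬝ᵥ B *ᵥ y
      set q := y ⬝ᵥ B *ᵥ y with hq
      have hq0 : 0 ≤ q := hp y hy
      have := hp (y + (-(q + 1) / (2 * m)) • v)
        (by rw [dotProduct_add, dotProduct_smul, hy, hpv, smul_zero, add_zero])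
      rw [h.symmB.quadForm_add_smul, hvB, h.symmB.dotProduct_mulVec_swap y v, ← hq] at this
      have e : 2 * (-(q + 1) / (2 * m)) * m = -(q + 1) := by field_simp
      change 0 ≤ q + 2 * m * (-(q + 1) / (2 * m)) + 0 * (-(q + 1) / (2 * m)) ^ 2 at this
      linarith
    have hs0 : s = 0 := by
      have := congrArg (· ⬝ᵥ x) (hs.symm.trans hc)
      simp only [smul_dotProduct, hkx, smul_eq_mul, mul_zero] at this
      exact (mul_eq_zero.mp this).resolve_right hpx
    have hv0 : v = 0 := by
      apply h.rad v (by rw [hFv, hpv, zero_smul]) (by rw [hs, hs0, zero_smul])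
      intro w hw _
      rw [dotProduct_mulVec_of_skew h.skew, hv, h.mulVec_mulVec_self, neg_dotProduct, neg_neg]
      exact h.dotProduct_eq_zero hw
    have := h.mulVec_mulVec_self k
    rw [← hv, hv0, mulVec_zero] at this
    exact hk0 (neg_eq_zero.mp this.symm)
  · set s := c / (p ⬝ᵥ v) with hs
    have hsc : s * (p ⬝ᵥ v) = c := div_mul_cancel₀ _ hpv
    have := (h.indef (-s) 1 fun y => ?_).2
    · exact one_ne_zero this
    set t := (p ⬝ᵥ y) / (p ⬝ᵥ v) with ht
    have htc : t * (p ⬝ᵥ v) = p ⬝ᵥ y := div_mul_cancel₀ _ hpv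
    have hpy : p ⬝ᵥ (y + (-t) • v) = 0 := by
      rw [dotProduct_add, dotProduct_smul, smul_eq_mul]
      linarith
    have h0 := hp _ hpy
    rw [h.symmB.quadForm_add_smul, hc, dotProduct_smul, dotProduct_smul, dotProduct_comm v,
      hkv, dotProduct_comm y k, smul_eq_mul] at h0
    rw [h.quadForm_eq]
    have : s * (p ⬝ᵥ y) = t * c := by rw [← htc, ← hsc]; ring
    have e : -s * (2 * (k ⬝ᵥ y) * (p ⬝ᵥ y)) = 2 * (-t) * (c * (k ⬝ᵥ y)) := by
      linear_combination (-2 * (k ⬝ᵥ y)) * this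
    rw [e]
    simp only [smul_eq_mul, mul_zero] at h0
    linarith

lemma exists_neg (h : SplitPair J F B p k) : ∃ x, k ⬝ᵥ x = 0 ∧ x ⬝ᵥ B *ᵥ x < 0 := by
  have := h.swap.not_nonneg
  push Not at this
  exact this

lemma exists_pos (h : SplitPair J F B p k) : ∃ x, k ⬝ᵥ x = 0 ∧ 0 < x ⬝ᵥ B *ᵥ x := by
  obtain ⟨x, hk, hx⟩ := h.neg.exists_neg
  rw [neg_mulVec, dotProduct_neg, neg_lt_zero] at hx
  exact ⟨x, hk, hx⟩

lemma bracket_eq_smul (h : SplitPair J F B p k) :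
    ∃ c : ℝ, B * J * F - F * J * B = c • F := by
  obtain ⟨c, hc⟩ := h.exists_eigen h.exists_pos h.exists_neg
  obtain ⟨c', hc'⟩ := h.swap.exists_eigen h.swap.exists_pos h.swap.exists_neg
  refine ⟨c + c', ext_of_mulVec_single fun i => ?_⟩
  generalize (Pi.single i 1 : n → ℝ) = x
  have e : ∀ (q : n → ℝ) (s : ℝ), B *ᵥ J *ᵥ q = s • q → q ⬝ᵥ J *ᵥ B *ᵥ x = -(s * (q ⬝ᵥ x)) := by
    intro q s hq
    rw [dotProduct_mulVec_of_skew h.skew, ← h.symmB.mulVec_dotProduct, hq, smul_dotProduct,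
      smul_eq_mul]
  rw [sub_mulVec, smul_mulVec, ← mulVec_mulVec, ← mulVec_mulVec, ← mulVec_mulVec,
    ← mulVec_mulVec, h.mulVec_eq (J *ᵥ B *ᵥ x), e k c hc, e p c' hc', h.mulVec_eq x, mulVec_add,
    mulVec_add, mulVec_smul, mulVec_smul, mulVec_smul, mulVec_smul, hc, hc']
  module

end SplitPair

/-- A symmetric form vanishing on the hyperplane orthogonal to `p` is the product of `p` with a
linear form. -/
lemma exists_factor_of_isotropic {F : Matrix n n ℝ} (hF : F.IsSymm) {p : n → ℝ} (hp : p ≠ 0)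
    (h : ∀ x, p ⬝ᵥ x = 0 → x ⬝ᵥ F *ᵥ x = 0) :
    ∃ k : n → ℝ, ∀ x, F *ᵥ x = (k ⬝ᵥ x) • p + (p ⬝ᵥ x) • k := by
  have hpp : p ⬝ᵥ p ≠ 0 := fun h0 => hp (dotProduct_self_eq_zero.mp h0)
  have hzero : ∀ x y, p ⬝ᵥ x = 0 → p ⬝ᵥ y = 0 → x ⬝ᵥ F *ᵥ y = 0 := fun x y hx hy =>
    dotProduct_mulVec_eq_zero_of_isotropic hF (orthogonalHyperplane p) h hx hy
  obtain ⟨e, hpe⟩ : ∃ e, p ⬝ᵥ e = 1 :=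
    ⟨(p ⬝ᵥ p)⁻¹ • p, by rw [dotProduct_smul, smul_eq_mul, inv_mul_cancel₀ hpp]⟩
  refine ⟨F *ᵥ e - ((e ⬝ᵥ F *ᵥ e) / 2) • p, fun x => ?_⟩
  refine dotProduct_eq _ _ fun y => ?_
  have hx : p ⬝ᵥ (x - (p ⬝ᵥ x) • e) = 0 := by
    rw [dotProduct_sub, dotProduct_smul, hpe, smul_eq_mul, mul_one, sub_self]
  have hy : p ⬝ᵥ (y - (p ⬝ᵥ y) • e) = 0 := by
    rw [dotProduct_sub, dotProduct_smul, hpe, smul_eq_mul, mul_one, sub_self]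
  have := hzero _ _ hx hy
  simp only [mulVec_sub, mulVec_smul, sub_dotProduct, dotProduct_sub, smul_dotProduct,
    dotProduct_smul, smul_eq_mul, add_dotProduct, hF.mulVec_dotProduct,
    hF.dotProduct_mulVec_swap x e] at this ⊢
  linear_combination this

/-- A component of the regular zeros that does not span forces the bracket into the span of the
two forms. -/
lemma exists_bracket_eq_of_component [DecidableEq n] {J A B : Matrix n n ℝ} (hA : A.IsSymm)
    (hB : B.IsSymm) (hAB : IndefinitePair A B) (hrank : 7 ≤ B.rank) (hJ : Jᵀ = -J)
    (hJJ : J * J = -1)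
    (hvanish : ∀ x, x ⬝ᵥ A *ᵥ x = 0 → x ⬝ᵥ B *ᵥ x = 0 →
      x ⬝ᵥ (B * J * A - A * J * B) *ᵥ x = 0)
    (hrad : ∀ v, A *ᵥ v = 0 → B *ᵥ v = 0 →
      (∀ w, A *ᵥ w = 0 → B *ᵥ w = 0 → v ⬝ᵥ J *ᵥ w = 0) → v = 0)
    (hspan : ∀ z ∈ regularZeros A B,
      Submodule.span ℝ (connectedComponentIn (regularZeros A B) z) ≠ ⊤) :
    ∃ a b : ℝ, B * J * A - A * J * B = a • A + b • B := by
  have hB3 := nonvanishingOnCodimThree_of_rank hB hrank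
  obtain ⟨z, hz⟩ := hAB.exists_regular hA hB hB3
  obtain ⟨f, hf0, hf⟩ := Submodule.exists_le_ker_of_lt_top _ (hspan z hz).lt_top
  have hfp : ∀ x, (fun i => f (Pi.single i 1)) ⬝ᵥ x = f x := by
    intro x
    rw [LinearMap.pi_apply_eq_sum_univ f x, dotProduct]
    refine Finset.sum_congr rfl fun i _ => ?_
    rw [smul_eq_mul, mul_comm]
    congr 2
    ext j
    simp [Pi.single_apply, eq_comm]
  set p : n → ℝ := fun i => f (Pi.single i 1)
  have hp : p ≠ 0 := by
    rintro h0
    apply hf0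
    refine LinearMap.ext fun x => ?_
    rw [← hfp, h0, zero_dotProduct, LinearMap.zero_apply]
  obtain ⟨α, β, hα, hF0⟩ := exists_combination_isotropic hA hB hB3 hz hp fun x hx => by
    rw [hfp]
    exact hf (Submodule.subset_span hx)
  have hF : (α • A + β • B).IsSymm := (hA.smul α).add (hB.smul β)
  obtain ⟨k, hk⟩ := exists_factor_of_isotropic hF hp hF0
  have hFx : ∀ x, (α • A + β • B) *ᵥ x = α • A *ᵥ x + β • B *ᵥ x := fun x => by
    rw [add_mulVec, smul_mulVec, smul_mulVec]
  have hsplit : SplitPair J (α • A + β • B) B p k :=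
    { symmF := hF
      symmB := hB
      mulVec_eq := hk
      indef := hAB.combination hα
      codim := hB3
      skew := hJ
      sq := hJJ
      vanish := fun x h1 h2 => by
        rw [hFx, dotProduct_add, dotProduct_smul, dotProduct_smul, h2, smul_zero, add_zero] at h1
        have h3 := hvanish x ((smul_eq_zero.mp h1).resolve_left hα) h2
        have h4 : x ⬝ᵥ A *ᵥ J *ᵥ B *ᵥ x = -(x ⬝ᵥ B *ᵥ J *ᵥ A *ᵥ x) := by
          rw [← hA.mulVec_dotProduct, dotProduct_mulVec_of_skew hJ, ← hB.mulVec_dotProduct,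
            dotProduct_comm]
        have h5 : x ⬝ᵥ B *ᵥ J *ᵥ B *ᵥ x = 0 := by
          have := dotProduct_mulVec_of_skew hJ (B *ᵥ x) (B *ᵥ x)
          rw [dotProduct_comm (J *ᵥ B *ᵥ x)] at this
          rw [← hB.mulVec_dotProduct]
          linarith
        rw [sub_mulVec, dotProduct_sub, ← mulVec_mulVec, ← mulVec_mulVec, ← mulVec_mulVec,
          ← mulVec_mulVec, h4] at h3
        rw [hFx, mulVec_add, mulVec_add, mulVec_smul, mulVec_smul, mulVec_smul, mulVec_smul,
          dotProduct_add, dotProduct_smul, dotProduct_smul, h5, smul_zero, add_zero, smul_eq_mul]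
        rw [show x ⬝ᵥ B *ᵥ J *ᵥ A *ᵥ x = 0 by linarith, mul_zero]
      rad := fun v h1 h2 h3 => by
        rw [hFx, h2, smul_zero, add_zero] at h1
        refine hrad v ((smul_eq_zero.mp h1).resolve_left hα) h2 fun w hAw hBw => h3 w ?_ hBw
        rw [hFx, hAw, hBw, smul_zero, smul_zero, add_zero] }
  obtain ⟨c, hc⟩ := hsplit.bracket_eq_smul
  refine ⟨c, α⁻¹ * c * β, ?_⟩
  have : α • (B * J * A - A * J * B) = α • (c • A + (α⁻¹ * c * β) • B) := by
    calc α • (B * J * A - A * J * B)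
        = B * J * (α • A + β • B) - (α • A + β • B) * J * B := by
          simp only [mul_add, add_mul, mul_smul_comm, smul_mul_assoc, smul_sub]
          abel
      _ = c • (α • A + β • B) := hc
      _ = α • (c • A + (α⁻¹ * c * β) • B) := by
          simp only [smul_add, smul_smul]
          congr 2
          · ring
          · field_simp
  exact smul_right_injective _ hα this

end SplitPairs

lemma symplJ_transpose (d : ℕ) : (symplJ d)ᵀ = -symplJ d := by
  simp [symplJ, fromBlocks_transpose, fromBlocks_neg]

lemma symplJ_mul_self (d : ℕ) : symplJ d * symplJ d = -1 := by
  rw [symplJ, fromBlocks_multiply, ← fromBlocks_one, fromBlocks_neg]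
  simp

/-- **Theorem 3.5.** Let `A, B ∈ Sym(2d,ℝ)` be linearly independent, forming a
non-dissipative pair with `max{rank A, rank B} ≥ 7`, and let `C := 2(BJA − AJB)` (so that
`Q_C = {Q_A, Q_B}`), with `Q_C` vanishing on `{Q_A = 0} ∩ {Q_B = 0}`. Assume the joint radical
`ker A ∩ ker B` is trivial or a symplectic subspace. If no connected component of the
transversal intersection set `𝒩` spans `ℝ^{2d}`, then `C` is a linear combination of `A`
and `B`. -/
theorem linear_combination_of_no_component_spans {d : ℕ}
    (A B : Matrix (Fin d ⊕ Fin d) (Fin d ⊕ Fin d) ℝ)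
    (hAs : A.IsSymm) (hBs : B.IsSymm)
    (hind : LinearIndependent ℝ ![A, B])
    (hnd : ∀ F ∈ Submodule.span ℝ
      ({A, B} : Set (Matrix (Fin d ⊕ Fin d) (Fin d ⊕ Fin d) ℝ)), F.PosSemidef → F = 0)
    (hrank : 7 ≤ max A.rank B.rank)
    (C : Matrix (Fin d ⊕ Fin d) (Fin d ⊕ Fin d) ℝ)
    (hC : C = (2 : ℝ) • (B * symplJ d * A - A * symplJ d * B))
    (hvanish : ∀ x : Fin d ⊕ Fin d → ℝ, x ⬝ᵥ A.mulVec x = 0 → x ⬝ᵥ B.mulVec x = 0 →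
      x ⬝ᵥ C.mulVec x = 0)
    (hrad : LinearMap.ker A.mulVecLin ⊓ LinearMap.ker B.mulVecLin = ⊥ ∨
      ∀ v ∈ LinearMap.ker A.mulVecLin ⊓ LinearMap.ker B.mulVecLin,
        (∀ w ∈ LinearMap.ker A.mulVecLin ⊓ LinearMap.ker B.mulVecLin,
          v ⬝ᵥ (symplJ d).mulVec w = 0) → v = 0)
    (N : Set (Fin d ⊕ Fin d → ℝ))
    (hN : N = {z : Fin d ⊕ Fin d → ℝ | z ⬝ᵥ A.mulVec z = 0 ∧ z ⬝ᵥ B.mulVec z = 0 ∧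
      LinearIndependent ℝ ![A.mulVec z, B.mulVec z]})
    (hspan : ∀ z ∈ N, Submodule.span ℝ (connectedComponentIn N z) ≠ ⊤) :
    ∃ α β : ℝ, C = α • A + β • B := by
  have hAB : IndefinitePair A B := by
    intro a b hab
    refine LinearIndependent.pair_iff.mp hind a b (hnd _ (Submodule.mem_span_pair.mpr
      ⟨a, b, rfl⟩) (PosSemidef.of_dotProduct_mulVec_nonneg ((hAs.smul a).add (hBs.smul b)) ?_))
    intro x
    simpa [add_mulVec, smul_mulVec, dotProduct_add, dotProduct_smul] using hab x
  have hrad' : ∀ v, A *ᵥ v = 0 → B *ᵥ v = 0 →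
      (∀ w, A *ᵥ w = 0 → B *ᵥ w = 0 → v ⬝ᵥ symplJ d *ᵥ w = 0) → v = 0 := by
    intro v hAv hBv hv
    have hmem : v ∈ LinearMap.ker A.mulVecLin ⊓ LinearMap.ker B.mulVecLin := ⟨hAv, hBv⟩
    rcases hrad with h0 | h0
    · rwa [h0, Submodule.mem_bot] at hmem
    · exact h0 v hmem fun w hw => hv w hw.1 hw.2
  have hvanish' : ∀ x, x ⬝ᵥ A *ᵥ x = 0 → x ⬝ᵥ B *ᵥ x = 0 →
      x ⬝ᵥ (B * symplJ d * A - A * symplJ d * B) *ᵥ x = 0 := by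
    intro x h1 h2
    have := hvanish x h1 h2
    rw [hC, smul_mulVec, dotProduct_smul] at this
    exact (smul_eq_zero.mp this).resolve_left two_ne_zero
  rcases le_max_iff.mp hrank with hr | hr
  · have hN' : N = regularZeros B A := by
      rw [hN]
      ext z
      exact ⟨fun h => ⟨h.2.1, h.1, LinearIndependent.pair_symm_iff.mp h.2.2⟩,
        fun h => ⟨h.2.1, h.1, LinearIndependent.pair_symm_iff.mp h.2.2⟩⟩
    obtain ⟨a, b, hab⟩ := exists_bracket_eq_of_component hBs hAs hAB.symm hr
      (symplJ_transpose d) (symplJ_mul_self d)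
      (fun x h1 h2 => by
        rw [← neg_sub, neg_mulVec, dotProduct_neg, hvanish' x h2 h1, neg_zero])
      (fun v h1 h2 h3 => hrad' v h2 h1 fun w hw1 hw2 => h3 w hw2 hw1)
      (hN' ▸ hspan)
    refine ⟨-(2 * b), -(2 * a), ?_⟩
    rw [hC, ← neg_sub, hab]
    module
  · obtain ⟨a, b, hab⟩ := exists_bracket_eq_of_component hAs hBs hAB hr
      (symplJ_transpose d) (symplJ_mul_self d) hvanish' hrad' (by subst hN; exact hspan)
    refine ⟨2 * a, 2 * b, ?_⟩
    rw [hC, hab]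
    module
end

section
/- Let A, B, C ∈ Sym(n,ℝ) and assume that Q_C(x) = 0 for every x with Q_A(x) = 0 and Q_B(x) = 0. Let x₀ ∈ ℝⁿ be such that Q_A(x₀) = 0, Q_B(x₀) = 0, and the vectors Ax₀ and Bx₀ are linearly independent. Then there exist α, β ∈ ℝ such that Cx₀ = αAx₀ + βBx₀, and such that Q_C(v) = αQ_A(v) + βQ_B(v) for every v ∈ ℝⁿ which is orthogonal to both Ax₀ and Bx₀ (with respect to the Euclidean inner product). -/
open Matrix

open Filter Topology

namespace Matrix

variable {m ι : Type*} [Fintype m]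

lemma IsSymm.dotProduct_mulVec_comm {M : Matrix m m ℝ} (hM : M.IsSymm) (u v : m → ℝ) :
    u ⬝ᵥ M *ᵥ v = v ⬝ᵥ M *ᵥ u := by
  rw [dotProduct_mulVec, dotProduct_comm, ← mulVec_transpose, hM.eq]

lemma IsSymm.hasStrictFDerivAt_dotProduct_mulVec {M : Matrix m m ℝ} (hM : M.IsSymm)
    (x : m → ℝ) :
    HasStrictFDerivAt (fun y : m → ℝ ↦ y ⬝ᵥ M *ᵥ y)
      ((2 : ℝ) • (dotProductBilin ℝ ℝ (M *ᵥ x)).toContinuousLinearMap) x := by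
  classical
  have h := ContinuousLinearMap.hasStrictFDerivAt_of_bilinear
    (LinearMap.toContinuousBilinearMap (toBilin' M)) (hasStrictFDerivAt_id x)
    (hasStrictFDerivAt_id x)
  refine (h.congr_fderiv ?_).congr_of_eventuallyEq (.of_forall fun y ↦ ?_)
  · ext v
    simp [toBilin'_apply', hM.dotProduct_mulVec_comm x v, dotProduct_comm (M *ᵥ x), two_mul]
  · simp [toBilin'_apply']

/-- If the gradients at `x₀` of finitely many quadratic forms vanishing at `x₀` are linearly
independent, then every vector orthogonal to these gradients is tangent to a curve of common
zeros. -/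
lemma exists_curve_of_linearIndependent [Fintype ι] {M : ι → Matrix m m ℝ}
    (hM : ∀ i, (M i).IsSymm) {x₀ : m → ℝ} (hx₀ : ∀ i, x₀ ⬝ᵥ M i *ᵥ x₀ = 0)
    (hli : LinearIndependent ℝ fun i ↦ M i *ᵥ x₀) {v : m → ℝ}
    (hv : ∀ i, v ⬝ᵥ M i *ᵥ x₀ = 0) :
    ∃ γ : ℝ → m → ℝ, γ 0 = x₀ ∧ HasDerivAt γ v 0 ∧
      ∀ᶠ t in 𝓝 0, ∀ i, γ t ⬝ᵥ M i *ᵥ γ t = 0 := by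
  let f : (m → ℝ) → ι → ℝ := fun x i ↦ x ⬝ᵥ M i *ᵥ x
  let f' : (m → ℝ) →L[ℝ] ι → ℝ := ContinuousLinearMap.pi fun i ↦
    (2 : ℝ) • (dotProductBilin ℝ ℝ (M i *ᵥ x₀)).toContinuousLinearMap
  have hf : HasStrictFDerivAt f f' x₀ :=
    hasStrictFDerivAt_pi.2 fun i ↦ (hM i).hasStrictFDerivAt_dotProduct_mulVec x₀
  have hf₀ : f x₀ = 0 := funext hx₀
  have hrange : f'.range = ⊤ := by
    let N : Matrix ι m ℝ := of fun i ↦ M i *ᵥ x₀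
    have hN : LinearMap.range N.mulVecLin = ⊤ := by
      apply Submodule.eq_top_of_finrank_eq
      rw [Module.finrank_fintype_fun_eq_card]
      exact LinearIndependent.rank_matrix (M := N) hli
    rw [LinearMap.range_eq_top] at hN ⊢
    intro y
    obtain ⟨w, hw⟩ := hN ((1 / 2 : ℝ) • y)
    refine ⟨w, funext fun i ↦ ?_⟩
    have hwi : M i *ᵥ x₀ ⬝ᵥ w = 1 / 2 * y i := congrFun hw i
    simp [f', hwi]
  have hker : v ∈ f'.ker := by
    rw [LinearMap.mem_ker]
    ext i
    simp [f', dotProduct_comm (M i *ᵥ x₀), hv i]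
  let w : f'.ker := ⟨v, hker⟩
  have hline : HasDerivAt (fun t : ℝ ↦ t • w) w 0 := by
    simpa using (hasDerivAt_id (0 : ℝ)).smul_const w
  refine ⟨fun t ↦ hf.implicitFunction f f' hrange (f x₀) (t • w), ?_, ?_, ?_⟩
  · simp
  · have h := (hf.to_implicitFunction hrange).hasFDerivAt
    rw [← zero_smul ℝ w] at h
    exact h.comp_hasDerivAt (0 : ℝ) hline
  · have ht : Tendsto (fun t : ℝ ↦ (f x₀, t • w)) (𝓝 0) (𝓝 (f x₀, 0)) := by
      have := hline.continuousAt.tendsto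
      rw [zero_smul] at this
      exact tendsto_const_nhds.prodMk_nhds this
    filter_upwards [ht.eventually (hf.map_implicitFunction_eq hrange)] with t h i
    exact congrFun (h.trans hf₀) i

/-- A quadratic form which vanishes along a curve through `x₀` and is singular at `x₀` also
vanishes at the velocity of the curve. -/
lemma dotProduct_mulVec_eq_zero_of_hasDerivAt {D : Matrix m m ℝ} (hD : D.IsSymm)
    {γ : ℝ → m → ℝ} {v : m → ℝ} (hγ : HasDerivAt γ v 0) (hsing : D *ᵥ γ 0 = 0)
    (hzero : ∀ᶠ t in 𝓝 0, γ t ⬝ᵥ D *ᵥ γ t = 0) : v ⬝ᵥ D *ᵥ v = 0 := by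
  have hcont : Continuous fun y : m → ℝ ↦ y ⬝ᵥ D *ᵥ y := by fun_prop
  have hlim := (hcont.tendsto v).comp hγ.tendsto_slope
  refine tendsto_nhds_unique (hlim.congr' ?_) tendsto_const_nhds
  filter_upwards [hzero.filter_mono nhdsWithin_le_nhds] with t ht
  simp [slope_def_module, mulVec_smul, mulVec_sub, sub_dotProduct, hsing, ht,
    hD.dotProduct_mulVec_comm (γ 0)]

end Matrix

/-- **Lemma 3.7.** Let `A, B, C ∈ Sym(n,ℝ)` with `Q_C` vanishing on
`{Q_A = 0} ∩ {Q_B = 0}`, and let `x₀` be a point of this intersection at which `Ax₀` and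
`Bx₀` are linearly independent. Then there are `α, β ∈ ℝ` with `Cx₀ = αAx₀ + βBx₀` and
`Q_C = αQ_A + βQ_B` on the subspace `V_{x₀} = {v : v ⊥ Ax₀, v ⊥ Bx₀}`. -/
theorem exists_local_coefficients {n : ℕ}
    (A B C : Matrix (Fin n) (Fin n) ℝ)
    (hAs : A.IsSymm) (hBs : B.IsSymm) (hCs : C.IsSymm)
    (hvanish : ∀ x : Fin n → ℝ, x ⬝ᵥ A.mulVec x = 0 → x ⬝ᵥ B.mulVec x = 0 →
      x ⬝ᵥ C.mulVec x = 0)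
    (x₀ : Fin n → ℝ)
    (hx₀A : x₀ ⬝ᵥ A.mulVec x₀ = 0) (hx₀B : x₀ ⬝ᵥ B.mulVec x₀ = 0)
    (hx₀ind : LinearIndependent ℝ ![A.mulVec x₀, B.mulVec x₀]) :
    ∃ α β : ℝ, C.mulVec x₀ = α • A.mulVec x₀ + β • B.mulVec x₀ ∧
      ∀ v : Fin n → ℝ, v ⬝ᵥ A.mulVec x₀ = 0 → v ⬝ᵥ B.mulVec x₀ = 0 →
        v ⬝ᵥ C.mulVec v = α * (v ⬝ᵥ A.mulVec v) + β * (v ⬝ᵥ B.mulVec v) := by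
  have hM : ∀ i, (![A, B] i).IsSymm := by simp [Fin.forall_fin_two, hAs, hBs]
  have hx₀ : ∀ i, x₀ ⬝ᵥ ![A, B] i *ᵥ x₀ = 0 := by simp [Fin.forall_fin_two, hx₀A, hx₀B]
  have hli : LinearIndependent ℝ fun i ↦ ![A, B] i *ᵥ x₀ := by
    convert! hx₀ind using 1
    ext i : 1
    fin_cases i <;> rfl
  have hcurve : ∀ v : Fin n → ℝ, v ⬝ᵥ A *ᵥ x₀ = 0 → v ⬝ᵥ B *ᵥ x₀ = 0 →
      ∃ γ : ℝ → Fin n → ℝ, γ 0 = x₀ ∧ HasDerivAt γ v 0 ∧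
        ∀ᶠ t in 𝓝 0, γ t ⬝ᵥ A *ᵥ γ t = 0 ∧ γ t ⬝ᵥ B *ᵥ γ t = 0 := by
    intro v hvA hvB
    have hv : ∀ i, v ⬝ᵥ ![A, B] i *ᵥ x₀ = 0 := by simp [Fin.forall_fin_two, hvA, hvB]
    simpa [Fin.forall_fin_two] using exists_curve_of_linearIndependent hM hx₀ hli hv
  have hperp : ∀ v : Fin n → ℝ, v ⬝ᵥ A *ᵥ x₀ = 0 → v ⬝ᵥ B *ᵥ x₀ = 0 → v ⬝ᵥ C *ᵥ x₀ = 0 := by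
    intro v hvA hvB
    obtain ⟨γ, rfl, hγ, hγ₀⟩ := hcurve v hvA hvB
    have hderiv := (hCs.hasStrictFDerivAt_dotProduct_mulVec (γ 0)).hasFDerivAt.comp_hasDerivAt
      (0 : ℝ) hγ
    have hzero : (fun t ↦ γ t ⬝ᵥ C *ᵥ γ t) =ᶠ[𝓝 0] fun _ ↦ 0 :=
      hγ₀.mono fun t ht ↦ hvanish _ ht.1 ht.2
    have h := hderiv.unique ((hasDerivAt_const (0 : ℝ) (0 : ℝ)).congr_of_eventuallyEq hzero)
    simpa [dotProduct_comm] using h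
  obtain ⟨α, β, hαβ⟩ : ∃ α β : ℝ, C *ᵥ x₀ = α • A *ᵥ x₀ + β • B *ᵥ x₀ := by
    have hspan : dotProductBilin ℝ ℝ (C *ᵥ x₀) ∈ Submodule.span ℝ
        (Set.range fun i ↦ dotProductBilin ℝ ℝ (![A, B] i *ᵥ x₀)) := by
      refine mem_span_of_iInf_ker_le_ker fun v hv ↦ ?_
      simp only [Submodule.mem_iInf, Fin.forall_fin_two, LinearMap.mem_ker] at hv ⊢
      exact (dotProduct_comm _ _).trans
        (hperp v ((dotProduct_comm _ _).trans hv.1) ((dotProduct_comm _ _).trans hv.2))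
    obtain ⟨c, hc⟩ := (Submodule.mem_span_range_iff_exists_fun ℝ).1 hspan
    refine ⟨c 0, c 1, dotProduct_eq _ _ fun v ↦ ?_⟩
    simpa [Fin.sum_univ_two] using (LinearMap.congr_fun hc v).symm
  refine ⟨α, β, hαβ, fun v hvA hvB ↦ ?_⟩
  obtain ⟨γ, rfl, hγ, hγ₀⟩ := hcurve v hvA hvB
  have h := dotProduct_mulVec_eq_zero_of_hasDerivAt (D := C - (α • A + β • B))
    (hCs.sub ((hAs.smul α).add (hBs.smul β))) hγ
    (by simp [sub_mulVec, add_mulVec, smul_mulVec, hαβ])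
    (hγ₀.mono fun t ht ↦ by
      simp [sub_mulVec, add_mulVec, smul_mulVec, ht.1, ht.2, hvanish _ ht.1 ht.2])
  simpa [sub_mulVec, add_mulVec, smul_mulVec, sub_eq_zero] using h
end

section
/- On ℝ⁴ = ℝ² × ℝ² with coordinates (x₁, x₂, y₁, y₂), let A, B ∈ Sym(4,ℝ) be the symmetric matrices of the quadratic forms Q_A(x,y) := x₁y₂ + x₂y₁ and Q_B(x,y) := x₁y₁ − x₂y₂, and let C := 2(BJA − AJB), so that Q_C = {Q_A, Q_B}. Then: (1) A and B are linearly independent and form a non-dissipative pair, and A is invertible (so maxrank{A,B} = 4); (2) the joint zero set {Q_A = 0} ∩ {Q_B = 0} equals {(x,y) ∈ ℝ² × ℝ² : x = 0 or y = 0}; (3) A, B and C are linearly independent; (4) nevertheless Q_C vanishes on {Q_A = 0} ∩ {Q_B = 0}. (Hence the conclusion of the form theorem fails when maxrank{A,B} = 4.) -/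
open Matrix

/-- The standard symplectic matrix `J = [[0, I₂], [−I₂, 0]]` on `ℝ⁴ = ℝ² × ℝ²`. -/
noncomputable def symplJ2 : Matrix (Fin 2 ⊕ Fin 2) (Fin 2 ⊕ Fin 2) ℝ :=
  Matrix.fromBlocks 0 1 (-1) 0

/-- A real symmetric matrix is determined by its quadratic form. -/
theorem Matrix.IsSymm.eq_of_quadraticForm_eq {n : Type*} [Fintype n] [DecidableEq n]
    {M N : Matrix n n ℝ} (hM : M.IsSymm) (hN : N.IsSymm)
    (h : ∀ z : n → ℝ, z ⬝ᵥ M.mulVec z = z ⬝ᵥ N.mulVec z) : M = N := by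
  ext i j
  have hi := h (Pi.single i 1)
  have hj := h (Pi.single j 1)
  have hij := h (Pi.single i 1 + Pi.single j 1)
  simp only [Matrix.mulVec_add, dotProduct_add, add_dotProduct, Matrix.mulVec_single_one,
    single_one_dotProduct, Matrix.col_apply] at hi hj hij
  have hMij := hM.apply i j
  have hNij := hN.apply i j
  linarith

/-- The matrix of the quadratic form `x₁y₂ + x₂y₁`. -/
noncomputable def crossMatrix : Matrix (Fin 2 ⊕ Fin 2) (Fin 2 ⊕ Fin 2) ℝ :=
  Matrix.fromBlocks 0 !![0, 1/2; 1/2, 0] !![0, 1/2; 1/2, 0] 0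

/-- The matrix of the quadratic form `x₁y₁ − x₂y₂`. -/
noncomputable def diffMatrix : Matrix (Fin 2 ⊕ Fin 2) (Fin 2 ⊕ Fin 2) ℝ :=
  Matrix.fromBlocks 0 !![1/2, 0; 0, -1/2] !![1/2, 0; 0, -1/2] 0

theorem crossMatrix_isSymm : crossMatrix.IsSymm := by
  refine Matrix.IsSymm.fromBlocks (by simp) ?_ (by simp)
  ext i j; fin_cases i <;> fin_cases j <;> simp

theorem diffMatrix_isSymm : diffMatrix.IsSymm := by
  refine Matrix.IsSymm.fromBlocks (by simp) ?_ (by simp)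
  ext i j; fin_cases i <;> fin_cases j <;> simp

theorem crossMatrix_quadraticForm (z : Fin 2 ⊕ Fin 2 → ℝ) :
    z ⬝ᵥ crossMatrix.mulVec z =
      z (Sum.inl 0) * z (Sum.inr 1) + z (Sum.inl 1) * z (Sum.inr 0) := by
  simp [crossMatrix, dotProduct, Matrix.mulVec, Fin.sum_univ_two]
  ring

theorem diffMatrix_quadraticForm (z : Fin 2 ⊕ Fin 2 → ℝ) :
    z ⬝ᵥ diffMatrix.mulVec z =
      z (Sum.inl 0) * z (Sum.inr 0) - z (Sum.inl 1) * z (Sum.inr 1) := by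
  simp [diffMatrix, dotProduct, Matrix.mulVec, Fin.sum_univ_two]
  ring

theorem isUnit_crossMatrix : IsUnit crossMatrix := by
  refine IsUnit.of_mul_eq_one ((4 : ℝ) • crossMatrix) ?_
  rw [crossMatrix, Matrix.fromBlocks_smul, Matrix.fromBlocks_multiply, ← Matrix.fromBlocks_one]
  congr 1 <;> ext i j <;> fin_cases i <;> fin_cases j <;> norm_num [Matrix.mul_apply]

theorem bracket_crossMatrix_diffMatrix :
    (2 : ℝ) • (diffMatrix * symplJ2 * crossMatrix - crossMatrix * symplJ2 * diffMatrix) =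
      Matrix.fromBlocks 0 !![0, -1; 1, 0] !![0, 1; -1, 0] 0 := by
  simp only [crossMatrix, diffMatrix, symplJ2, Matrix.fromBlocks_multiply, sub_eq_add_neg,
    Matrix.fromBlocks_neg, Matrix.fromBlocks_add, Matrix.fromBlocks_smul]
  congr 1 <;> ext i j <;> fin_cases i <;> fin_cases j <;> norm_num [Matrix.mul_apply]

/-- **Remark 3.6 (a).** On `ℝ⁴ = ℝ² × ℝ²` with coordinates `(x₁,x₂,y₁,y₂)`,
let `A, B` be the symmetric matrices of `Q_A(x,y) = x₁y₂ + x₂y₁` and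
`Q_B(x,y) = x₁y₁ − x₂y₂`, and `C := 2(BJA − AJB)` (so `Q_C = {Q_A, Q_B}`). Then:
(1) `A, B` are linearly independent, form a non-dissipative pair, and `A` is invertible;
(2) `{Q_A = 0} ∩ {Q_B = 0} = {(x,y) : x = 0 ∨ y = 0}`;
(3) `A, B, C` are linearly independent;
(4) nevertheless `Q_C` vanishes on `{Q_A = 0} ∩ {Q_B = 0}`. -/
theorem counterexample_rank_four
    (A B : Matrix (Fin 2 ⊕ Fin 2) (Fin 2 ⊕ Fin 2) ℝ)
    (hAs : A.IsSymm) (hBs : B.IsSymm)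
    (hA : ∀ z : Fin 2 ⊕ Fin 2 → ℝ, z ⬝ᵥ A.mulVec z =
      z (Sum.inl 0) * z (Sum.inr 1) + z (Sum.inl 1) * z (Sum.inr 0))
    (hB : ∀ z : Fin 2 ⊕ Fin 2 → ℝ, z ⬝ᵥ B.mulVec z =
      z (Sum.inl 0) * z (Sum.inr 0) - z (Sum.inl 1) * z (Sum.inr 1))
    (C : Matrix (Fin 2 ⊕ Fin 2) (Fin 2 ⊕ Fin 2) ℝ)
    (hC : C = (2 : ℝ) • (B * symplJ2 * A - A * symplJ2 * B)) :
    (LinearIndependent ℝ ![A, B] ∧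
      (∀ F ∈ Submodule.span ℝ ({A, B} : Set (Matrix (Fin 2 ⊕ Fin 2) (Fin 2 ⊕ Fin 2) ℝ)),
        F.PosSemidef → F = 0) ∧
      IsUnit A) ∧
    ({z : Fin 2 ⊕ Fin 2 → ℝ | z ⬝ᵥ A.mulVec z = 0 ∧ z ⬝ᵥ B.mulVec z = 0} =
      {z : Fin 2 ⊕ Fin 2 → ℝ | (∀ i, z (Sum.inl i) = 0) ∨ (∀ i, z (Sum.inr i) = 0)}) ∧
    LinearIndependent ℝ ![A, B, C] ∧
    (∀ z : Fin 2 ⊕ Fin 2 → ℝ, z ⬝ᵥ A.mulVec z = 0 → z ⬝ᵥ B.mulVec z = 0 →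
      z ⬝ᵥ C.mulVec z = 0) := by
  obtain rfl : A = crossMatrix := hAs.eq_of_quadraticForm_eq crossMatrix_isSymm
    fun z => (hA z).trans (crossMatrix_quadraticForm z).symm
  obtain rfl : B = diffMatrix := hBs.eq_of_quadraticForm_eq diffMatrix_isSymm
    fun z => (hB z).trans (diffMatrix_quadraticForm z).symm
  rw [bracket_crossMatrix_diffMatrix] at hC
  have zero_set : ∀ z : Fin 2 ⊕ Fin 2 → ℝ, z ⬝ᵥ crossMatrix.mulVec z = 0 →
      z ⬝ᵥ diffMatrix.mulVec z = 0 →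
      (∀ i, z (Sum.inl i) = 0) ∨ (∀ i, z (Sum.inr i) = 0) := by
    intro z h₁ h₂
    rw [hA] at h₁
    rw [hB] at h₂
    have hprod : (z (Sum.inl 0) ^ 2 + z (Sum.inl 1) ^ 2) *
        (z (Sum.inr 0) ^ 2 + z (Sum.inr 1) ^ 2) = 0 := by
      linear_combination (z (Sum.inl 0) * z (Sum.inr 1) + z (Sum.inl 1) * z (Sum.inr 0)) * h₁ +
        (z (Sum.inl 0) * z (Sum.inr 0) - z (Sum.inl 1) * z (Sum.inr 1)) * h₂
    rw [Fin.forall_fin_two, Fin.forall_fin_two]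
    refine (mul_eq_zero.mp hprod).imp (fun h => ?_) (fun h => ?_) <;>
      constructor <;> nlinarith
  have indep : LinearIndependent ℝ ![crossMatrix, diffMatrix, C] := by
    rw [Fintype.linearIndependent_iff]
    intro g hg
    have h₀ := congrFun₂ hg (Sum.inl 0) (Sum.inr 0)
    have h₁ := congrFun₂ hg (Sum.inl 0) (Sum.inr 1)
    have h₂ := congrFun₂ hg (Sum.inl 1) (Sum.inr 0)
    simp [Fin.sum_univ_three, hC, crossMatrix, diffMatrix] at h₀ h₁ h₂
    intro i
    fin_cases i <;> simp <;> linarith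
  refine ⟨⟨?_, ?_, isUnit_crossMatrix⟩, ?_, indep, ?_⟩
  · rw [LinearIndependent.pair_iff]
    intro s t hst
    have h₀ := congrFun₂ hst (Sum.inl 0) (Sum.inr 0)
    have h₁ := congrFun₂ hst (Sum.inl 0) (Sum.inr 1)
    simp [crossMatrix, diffMatrix] at h₀ h₁
    exact ⟨h₁, h₀⟩
  · intro F hF hpos
    obtain ⟨a, b, rfl⟩ := Submodule.mem_span_pair.mp hF
    have nonneg : ∀ z : Fin 2 ⊕ Fin 2 → ℝ,
        0 ≤ a * (z (Sum.inl 0) * z (Sum.inr 1) + z (Sum.inl 1) * z (Sum.inr 0)) +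
          b * (z (Sum.inl 0) * z (Sum.inr 0) - z (Sum.inl 1) * z (Sum.inr 1)) := by
      intro z
      have h := hpos.dotProduct_mulVec_nonneg z
      rwa [star_trivial, Matrix.add_mulVec, Matrix.smul_mulVec, Matrix.smul_mulVec,
        dotProduct_add, dotProduct_smul, dotProduct_smul, hA, hB] at h
    have h₁ := nonneg (Sum.elim ![1, 0] ![0, 1])
    have h₂ := nonneg (Sum.elim ![1, 0] ![0, -1])
    have h₃ := nonneg (Sum.elim ![1, 0] ![1, 0])
    have h₄ := nonneg (Sum.elim ![1, 0] ![-1, 0])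
    simp at h₁ h₂ h₃ h₄
    rw [le_antisymm h₂ h₁, le_antisymm h₄ h₃]
    simp
  · ext z
    refine ⟨fun h => zero_set z h.1 h.2, fun h => ?_⟩
    rw [Set.mem_ofPred_eq, hA, hB]
    rcases h with h | h <;> simp [h]
  · intro z h₁ h₂
    rw [hC]
    rcases zero_set z h₁ h₂ with h | h <;> simp [dotProduct, Matrix.mulVec, h]
end

section
/- On ℝ², let A, B ∈ Sym(2,ℝ) be the symmetric matrices of the quadratic forms Q_A(x,y) := x² − y² and Q_B(x,y) := xy. Then A and B are linearly independent and form a non-dissipative pair with maxrank{A,B} = 2, but there exists no point z ∈ ℝ² with Q_A(z) = 0, Q_B(z) = 0 and Az, Bz linearly independent. (Hence the transversal-intersection theorem fails for maxrank equal to 2.) -/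
open Matrix

/-- **Remark 2.10.** On `ℝ²`, let `A, B` be the symmetric matrices of
`Q_A(x,y) = x² − y²` and `Q_B(x,y) = xy`. Then `A, B` are linearly independent and form a
non-dissipative pair with `maxrank{A,B} = 2`, yet there is no point `z` with
`Q_A(z) = Q_B(z) = 0` at which `Az` and `Bz` are linearly independent. -/
theorem counterexample_rank_two
    (A B : Matrix (Fin 2) (Fin 2) ℝ) (hAs : A.IsSymm) (hBs : B.IsSymm)
    (hA : ∀ z : Fin 2 → ℝ, z ⬝ᵥ A.mulVec z = z 0 ^ 2 - z 1 ^ 2)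
    (hB : ∀ z : Fin 2 → ℝ, z ⬝ᵥ B.mulVec z = z 0 * z 1) :
    LinearIndependent ℝ ![A, B] ∧
    (∀ F ∈ Submodule.span ℝ ({A, B} : Set (Matrix (Fin 2) (Fin 2) ℝ)),
      F.PosSemidef → F = 0) ∧
    ((∃ F ∈ Submodule.span ℝ ({A, B} : Set (Matrix (Fin 2) (Fin 2) ℝ)), F.rank = 2) ∧
      (∀ F ∈ Submodule.span ℝ ({A, B} : Set (Matrix (Fin 2) (Fin 2) ℝ)), F.rank ≤ 2)) ∧
    ¬ (∃ z : Fin 2 → ℝ, z ⬝ᵥ A.mulVec z = 0 ∧ z ⬝ᵥ B.mulVec z = 0 ∧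
      LinearIndependent ℝ ![A.mulVec z, B.mulVec z]) := by
  obtain rfl : A = !![1, 0; 0, -1] := by
    have h₀ := hA ![1, 0]
    have h₁ := hA ![0, 1]
    have h₂ := hA ![1, 1]
    have hs := hAs.apply 0 1
    simp [Matrix.mulVec, dotProduct, Fin.sum_univ_two] at h₀ h₁ h₂
    ext i j
    fin_cases i <;> fin_cases j <;> simp <;> linarith
  obtain rfl : B = !![0, 1 / 2; 1 / 2, 0] := by
    have h₀ := hB ![1, 0]
    have h₁ := hB ![0, 1]
    have h₂ := hB ![1, 1]
    have hs := hBs.apply 0 1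
    simp [Matrix.mulVec, dotProduct, Fin.sum_univ_two] at h₀ h₁ h₂
    ext i j
    fin_cases i <;> fin_cases j <;> simp <;> linarith
  refine ⟨?_, ?_, ⟨⟨!![1, 0; 0, -1], Submodule.subset_span (by simp), ?_⟩, ?_⟩, ?_⟩
  · rw [LinearIndependent.pair_iff]
    intro s t h
    have h₀ := congrFun₂ h 0 0
    have h₁ := congrFun₂ h 0 1
    simp at h₀ h₁
    exact ⟨h₀, h₁⟩
  · intro F hF hpos
    obtain ⟨a, b, rfl⟩ := Submodule.mem_span_pair.1 hF
    exact hpos.trace_eq_zero_iff.1 (by simp [Matrix.trace_fin_two])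
  · have hu : IsUnit (!![1, 0; 0, -1] : Matrix (Fin 2) (Fin 2) ℝ) := by
      simp [Matrix.isUnit_iff_isUnit_det, Matrix.det_fin_two]
    simpa using Matrix.rank_of_isUnit _ hu
  · intro F _
    simpa using F.rank_le_card_width
  · rintro ⟨z, hzA, hzB, hz⟩
    rw [hA] at hzA
    rw [hB] at hzB
    have hz₀ : z = 0 := by
      have h : z 0 = 0 ∧ z 1 = 0 := by
        rcases mul_eq_zero.1 hzB with h | h <;> simpa [h] using hzA
      ext i
      fin_cases i
      exacts [h.1, h.2]
    exact hz.ne_zero 0 (by simp [hz₀])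
end
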